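/- arXiv:2109.02932 — 2 statements merged into one kernel-verified Lean document; each statement's English description precedes it below -/
import Mathlib

section
/- Let f, g ∈ ℤ[X] be monic polynomials of degree n ≥ 2 with nonzero discriminant, and let α ∈ K_f := ℚ[X]/(f) and β ∈ K_g := ℚ[X]/(g) be the residue classes of X. Then f and g are Hermite equivalent if and only if there exists a ℚ-algebra isomorphism φ : K_f → K_g mapping the subring ℤ[α] (the ℤ-subalgebra of K_f generated by α) onto the subring ℤ[β]. -/
open Polynomial

/-- The Hermite form `[f]` of an integer polynomial viewed as degree `n`:
`f₀^(n-1) · ∏ᵢ (αᵢ^(n-1) X₁ + αᵢ^(n-2) X₂ + ⋯ + X_n)`, where the `αᵢ` are the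
complex roots of `f` counted with multiplicity. -/
noncomputable def hermiteForm (n : ℕ) (f : Polynomial ℤ) : MvPolynomial (Fin n) ℂ :=
  MvPolynomial.C ((f.leadingCoeff : ℂ) ^ (n - 1)) *
    (Multiset.map
      (fun α : ℂ => ∑ j : Fin n, MvPolynomial.C (α ^ (n - 1 - (j : ℕ))) * MvPolynomial.X j)
      ((f.map (Int.castRingHom ℂ)).roots)).prod

/-- `f` and `g`, viewed as degree-`n` polynomials, are Hermite equivalent if there are
`U ∈ GL_n(ℤ)` and `ε ∈ {1,-1}` with `[g](U·X) = ε·[f](X)`. -/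
def HermiteEquiv (n : ℕ) (f g : Polynomial ℤ) : Prop :=
  ∃ (U : Matrix (Fin n) (Fin n) ℤ) (ε : ℤ), IsUnit U.det ∧ (ε = 1 ∨ ε = -1) ∧
    MvPolynomial.bind₁
        (fun i : Fin n => ∑ j : Fin n, MvPolynomial.C ((U i j : ℂ)) * MvPolynomial.X j)
        (hermiteForm n g)
      = MvPolynomial.C ((ε : ℂ)) * hermiteForm n f

/-- The translate `(f∘M)(X) = ∑ₖ f_k (aX+b)^k (cX+d)^(n-k)` of `f`, viewed as a
degree-`n` polynomial, by the matrix `M = (a b; c d)`. -/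
noncomputable def glTranslate (n : ℕ) (f : Polynomial ℤ) (M : Matrix (Fin 2) (Fin 2) ℤ) : Polynomial ℤ :=
  ∑ k ∈ Finset.range (n + 1),
    Polynomial.C (f.coeff k) * (Polynomial.C (M 0 0) * Polynomial.X + Polynomial.C (M 0 1)) ^ k *
      (Polynomial.C (M 1 0) * Polynomial.X + Polynomial.C (M 1 1)) ^ (n - k)

/-- `f` and `g`, viewed as degree-`n` polynomials, are `GL₂(ℤ)`-equivalent if
`g = ±(f∘M)` for some `M ∈ GL₂(ℤ)`. -/
def GL2Equiv (n : ℕ) (f g : Polynomial ℤ) : Prop :=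
  ∃ M : Matrix (Fin 2) (Fin 2) ℤ, IsUnit M.det ∧
    (g = glTranslate n f M ∨ g = -glTranslate n f M)

/-- The list of complex roots of `f`, counted with multiplicity (in some order). -/
noncomputable def rootList (f : Polynomial ℤ) : List ℂ :=
  ((f.map (Int.castRingHom ℂ)).roots).toList

/-- The discriminant `D(f) = f₀^(2n-2) ∏_{i<j} (αᵢ - α_j)²` of `f` (as a complex number;
it is independent of the ordering of the roots since the product is symmetric). -/
noncomputable def discC (f : Polynomial ℤ) : ℂ :=
  (f.leadingCoeff : ℂ) ^ (2 * f.natDegree - 2) *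
    ∏ p : Fin (rootList f).length × Fin (rootList f).length,
      if (p.1 : ℕ) < (p.2 : ℕ) then ((rootList f).get p.1 - (rootList f).get p.2) ^ 2 else 1

/-- `K_f := ℚ[X]/(f)`. -/
abbrev Kf (f : Polynomial ℤ) : Type := AdjoinRoot (f.map (Int.castRingHom ℚ))

/-- The residue class `α` of `X` in `K_f`. -/
noncomputable def rootOf (f : Polynomial ℤ) : Kf f := AdjoinRoot.root _

/-- `ζᵢ = f₀ αⁱ + f₁ α^(i-1) + ⋯ + f_{i-1} α`, where `f_j` is the coefficient of
`X^(n-j)` in `f`. -/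
noncomputable def zeta (f : Polynomial ℤ) (i : ℕ) : Kf f :=
  ∑ j ∈ Finset.range i, ((f.coeff (f.natDegree - j) : ℤ) : Kf f) * rootOf f ^ (i - j)

/-- The invariant module `I_f(k)`: the ℤ-span of `1, α, …, α^k, ζ_{k+1}, …, ζ_{n-1}`
inside `K_f`.  In particular `R_f = I_f(0)` and `I_f = I_f(1)`. -/
noncomputable def invModule (f : Polynomial ℤ) (k : ℕ) : Submodule ℤ (Kf f) :=
  Submodule.span ℤ
    ({x | ∃ j ≤ k, x = rootOf f ^ j} ∪
     {x | ∃ i, k + 1 ≤ i ∧ i ≤ f.natDegree - 1 ∧ x = zeta f i})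

/-- `f` and `g` are ℤ-equivalent: `g(X) = εⁿ f(εX + a)` with `ε = ±1`, `a ∈ ℤ`. -/
def ZEquiv (f g : Polynomial ℤ) : Prop :=
  ∃ ε a : ℤ, (ε = 1 ∨ ε = -1) ∧
    g = Polynomial.C (ε ^ f.natDegree) * f.comp (Polynomial.C ε * Polynomial.X + Polynomial.C a)

/-- The `(n-2)`-th partial sum `a⁽ⁿ⁾(X) = ∑_{i=0}^{n-2} Cᵢ Xⁱ` of the Catalan
generating function. -/
noncomputable def aPoly (n : ℕ) : Polynomial ℤ :=
  ∑ i ∈ Finset.range (n - 1), Polynomial.C ((catalan i : ℤ)) * Polynomial.X ^ i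

open scoped Matrix

/-- The linear form `∑ⱼ vⱼ Xⱼ`. -/
noncomputable def linForm {n : ℕ} (v : Fin n → ℂ) : MvPolynomial (Fin n) ℂ :=
  ∑ j, MvPolynomial.C (v j) * MvPolynomial.X j

/-- The vector `(x^(n-1), …, x, 1)`. -/
def revPow {R : Type*} [Monoid R] (n : ℕ) (x : R) : Fin n → R := fun j => x ^ (n - 1 - (j : ℕ))

theorem coeff_linForm {n : ℕ} (v : Fin n → ℂ) (j : Fin n) :
    (linForm v).coeff (Finsupp.single j 1) = v j := by
  classical
  simp [linForm, MvPolynomial.coeff_sum, MvPolynomial.coeff_C_mul, MvPolynomial.coeff_X,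
    Finsupp.single_left_inj]

theorem linForm_smul {n : ℕ} (c : ℂ) (v : Fin n → ℂ) :
    linForm (c • v) = MvPolynomial.C c * linForm v := by
  simp [linForm, Finset.mul_sum, mul_assoc]

theorem bind₁_linForm {n : ℕ} (U : Matrix (Fin n) (Fin n) ℂ) (v : Fin n → ℂ) :
    MvPolynomial.bind₁ (fun i => ∑ j, MvPolynomial.C (U i j) * MvPolynomial.X j) (linForm v) =
      linForm (v ᵥ* U) := by
  simp only [linForm, map_sum, map_mul, MvPolynomial.bind₁_X_right, Finset.mul_sum,
    Matrix.vecMul, dotProduct, Finset.sum_mul, MvPolynomial.algHom_C, MvPolynomial.algebraMap_eq]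
  rw [Finset.sum_comm]
  simp only [mul_assoc]

theorem totalDegree_linForm {n : ℕ} {v : Fin n → ℂ} (hv : v ≠ 0) :
    (linForm v).totalDegree = 1 := by
  obtain ⟨j, hj⟩ := Function.ne_iff.mp hv
  apply le_antisymm
  · refine MvPolynomial.totalDegree_finsetSum_le fun i _ => ?_
    refine (MvPolynomial.totalDegree_mul _ _).trans ?_
    simp
  · have := MvPolynomial.le_totalDegree (p := linForm v) (s := Finsupp.single j 1)
      (by rw [MvPolynomial.mem_support_iff, coeff_linForm]; exact hj)
    simpa using this

theorem prime_linForm {n : ℕ} {v : Fin n → ℂ} (hv : v ≠ 0) : Prime (linForm v) := by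
  obtain ⟨j, hj⟩ := Function.ne_iff.mp hv
  refine (MvPolynomial.irreducible_of_totalDegree_eq_one (totalDegree_linForm hv)
    fun x hx => ?_).prime
  refine isUnit_iff_ne_zero.mpr ?_
  rintro rfl
  have := hx (Finsupp.single j 1)
  rw [coeff_linForm, zero_dvd_iff] at this
  exact hj this

theorem exists_smul_eq_of_linForm_dvd {n : ℕ} {v w : Fin n → ℂ} (hv : v ≠ 0) (hw : w ≠ 0)
    (h : linForm v ∣ linForm w) : ∃ c : ℂ, c ≠ 0 ∧ w = c • v := by
  obtain ⟨q, hq⟩ := h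
  have hw' := (prime_linForm hw).ne_zero
  have hq0 : q ≠ 0 := by rintro rfl; simp [hw'] at hq
  have hd := congrArg MvPolynomial.totalDegree hq
  rw [MvPolynomial.totalDegree_mul_of_isDomain (prime_linForm hv).ne_zero hq0,
    totalDegree_linForm hv, totalDegree_linForm hw] at hd
  have hqC := MvPolynomial.totalDegree_eq_zero_iff_eq_C.mp (by lia : q.totalDegree = 0)
  refine ⟨q.coeff 0, ?_, ?_⟩
  · intro h0
    rw [h0, map_zero] at hqC
    exact hq0 hqC
  · ext j
    rw [← coeff_linForm w, ← coeff_linForm (_ • v), linForm_smul, ← hqC, hq, mul_comm]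

theorem revPow_last {R : Type*} [Monoid R] {n : ℕ} (h : n - 1 < n) (x : R) :
    revPow n x ⟨n - 1, h⟩ = 1 := by
  simp [revPow]

theorem revPow_penultimate {R : Type*} [Monoid R] {n : ℕ} (hn : 2 ≤ n) (x : R) :
    revPow n x ⟨n - 2, by lia⟩ = x := by
  have : n - 1 - (n - 2) = 1 := by lia
  simp [revPow, this]

theorem revPow_ne_zero {R : Type*} [Semiring R] [Nontrivial R] {n : ℕ} (hn : 2 ≤ n) (x : R) :
    revPow n x ≠ 0 := fun h => by
  have := congrFun h ⟨n - 1, by lia⟩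
  rw [revPow_last] at this
  simp at this

theorem map_revPow {R S F : Type*} [Monoid R] [Monoid S] [FunLike F R S] [MonoidHomClass F R S]
    (φ : F) (n : ℕ) (x : R) (j : Fin n) : φ (revPow n x j) = revPow n (φ x) j := by
  simp [revPow]

theorem vecMul_ne_zero_of_isUnit_det {n : ℕ} {U : Matrix (Fin n) (Fin n) ℤ} (hU : IsUnit U.det)
    {v : Fin n → ℂ} (hv : v ≠ 0) : v ᵥ* U.map (Int.cast : ℤ → ℂ) ≠ 0 := by
  have h : IsUnit (U.map (Int.castRingHom ℂ)) := by
    have := ((Matrix.isUnit_iff_isUnit_det _).mpr hU).map (Int.castRingHom ℂ).mapMatrix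
    simpa using this
  intro h0
  exact hv (Matrix.vecMul_injective_of_isUnit h (by simpa using h0))

theorem nodup_roots_of_discC_ne_zero {f : ℤ[X]} (h : discC f ≠ 0) : (f.aroots ℂ).Nodup := by
  have h' := right_ne_zero_of_mul h
  rw [Finset.prod_ne_zero_iff] at h'
  have key : ∀ i j : Fin (rootList f).length, i < j → (rootList f).get i ≠ (rootList f).get j := by
    intro i j hij he
    have := h' (i, j) (Finset.mem_univ _)
    exact this (by simp only [if_pos (Fin.lt_def.mp hij), he]; simp)
  have hl : (rootList f).Nodup := by
    rw [List.nodup_iff_injective_get]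
    intro i j hij
    by_contra hne
    rcases lt_or_gt_of_ne hne with hlt | hlt
    · exact key i j hlt hij
    · exact key j i hlt hij.symm
  rw [← Multiset.coe_toList (f.aroots ℂ)]
  exact Multiset.coe_nodup.mpr hl

theorem card_rootSet_of_nodup {f : ℤ[X]} (hf : f.Monic) (h : (f.aroots ℂ).Nodup) :
    Fintype.card (f.rootSet ℂ) = f.natDegree := by
  classical
  rw [← hf.natDegree_map (algebraMap ℤ ℂ), (IsAlgClosed.splits _).natDegree_eq_card_roots]
  rw [← Nat.card_eq_fintype_card, rootSet_def, Nat.card_coe_set_eq, Set.ncard_coe_finset]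
  exact Multiset.toFinset_card_of_nodup h

theorem hermiteForm_eq_prod {f : ℤ[X]} (n : ℕ) (hf : f.Monic) (h : (f.aroots ℂ).Nodup) :
    hermiteForm n f = ∏ z : f.rootSet ℂ, linForm (revPow n (z : ℂ)) := by
  classical
  have : ∏ z : f.rootSet ℂ, linForm (revPow n (z : ℂ)) =
      ∏ z ∈ (f.aroots ℂ).toFinset, linForm (revPow n (z : ℂ)) := by
    symm
    refine Finset.prod_subtype _ (fun x => ?_) _
    simp [rootSet_def]
  rw [this, hermiteForm, hf.leadingCoeff, Finset.prod_eq_multiset_prod, Multiset.toFinset_val,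
    h.dedup]
  simp [linForm, revPow, aroots_def]

/-- The embedding `K_f → ℂ` sending the class of `X` to a given root of `f`. -/
noncomputable def evalRoot (f : ℤ[X]) (z : f.rootSet ℂ) : Kf f →ₐ[ℚ] ℂ :=
  AdjoinRoot.liftAlgHom _ (Algebra.ofId ℚ ℂ) z (by
    have := (mem_rootSet'.mp z.2).2
    rw [aeval_def] at this
    rw [Algebra.toRingHom_ofId, eval₂_map, ← this]
    congr 1)

@[simp]
theorem evalRoot_rootOf (f : ℤ[X]) (z : f.rootSet ℂ) : evalRoot f z (rootOf f) = z :=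
  AdjoinRoot.liftAlgHom_root ..

theorem eq_of_evalRoot_eq {f : ℤ[X]} (hf : f.Monic) (h : (f.aroots ℂ).Nodup) {x y : Kf f}
    (hxy : ∀ z, evalRoot f z x = evalRoot f z y) : x = y := by
  rw [← sub_eq_zero]
  obtain ⟨p, hp⟩ := AdjoinRoot.mk_surjective (x - y)
  rw [← hp, AdjoinRoot.mk_eq_zero, ← map_dvd_map' (algebraMap ℚ ℂ), Polynomial.map_map]
  have hcomp : (algebraMap ℚ ℂ).comp (Int.castRingHom ℚ) = algebraMap ℤ ℂ := by ext; simp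
  rw [hcomp]
  by_cases hp0 : p = 0
  · simp [hp0]
  have hp0' : p.map (algebraMap ℚ ℂ) ≠ 0 := by simpa using hp0
  have hs := (IsAlgClosed.splits (f.map (algebraMap ℤ ℂ))).eq_prod_roots_of_monic
    (hf.map _)
  rw [hs, Multiset.prod_X_sub_C_dvd_iff_le_roots hp0', Multiset.le_iff_subset h]
  intro z hz
  have hz' : z ∈ f.rootSet ℂ := by classical simpa [rootSet_def] using hz
  have : evalRoot f ⟨z, hz'⟩ (AdjoinRoot.mk _ p) = 0 := by
    rw [hp, map_sub, sub_eq_zero, hxy]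
  rw [mem_roots hp0', IsRoot, eval_map]
  exact this

theorem aeval_rootOf (f : ℤ[X]) : aeval (rootOf f) f = 0 := by
  have := AdjoinRoot.eval₂_root (f.map (Int.castRingHom ℚ))
  rw [eval₂_map] at this
  rw [aeval_def, rootOf, ← this]
  congr 1

theorem span_revPow {R A : Type*} [CommRing R] [CommRing A] [Algebra R A] {f : R[X]} (hf : f.Monic) {x : A}
    (hx : aeval x f = 0) :
    Submodule.span R (Set.range (revPow f.natDegree x)) =
      Subalgebra.toSubmodule (Algebra.adjoin R {x}) := by
  rw [← Submodule.span_range_natDegree_eq_adjoin hf hx]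
  congr 1
  ext y
  simp only [Set.mem_range, revPow, Finset.coe_image, Finset.coe_range, Set.mem_image, Set.mem_Iio]
  constructor
  · rintro ⟨j, rfl⟩
    exact ⟨_, by lia, rfl⟩
  · rintro ⟨k, hk, rfl⟩
    exact ⟨⟨f.natDegree - 1 - k, by lia⟩, by simp only; congr 1; lia⟩

theorem linearIndependent_revPow_rootOf {f : ℤ[X]} (hf : f.Monic) :
    LinearIndependent ℤ (revPow f.natDegree (rootOf f)) := by
  have hm := hf.map (Int.castRingHom ℚ)
  let b := AdjoinRoot.powerBasis hm.ne_zero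
  have hdim : b.dim = f.natDegree := hf.natDegree_map _
  have hb := b.basis.linearIndependent.restrict_scalars (R := ℤ)
    (by simpa using Int.cast_injective)
  have := hb.comp (fun j : Fin f.natDegree => Fin.cast hdim.symm j.rev)
    (fun i j h => by simpa using h)
  convert this using 1
  ext j
  simp only [revPow, Function.comp, b.basis_eq_pow]
  change rootOf f ^ _ = rootOf f ^ _
  congr 1
  simp; lia

theorem span_range_sum_smul {R M : Type*} [CommRing R] [AddCommGroup M] [Module R M] {n : ℕ}
    {U : Matrix (Fin n) (Fin n) R} (hU : IsUnit U.det) (x : Fin n → M) :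
    Submodule.span R (Set.range fun j => ∑ i, U i j • x i) = Submodule.span R (Set.range x) := by
  apply le_antisymm
  · rw [Submodule.span_le]
    rintro _ ⟨j, rfl⟩
    exact Submodule.sum_mem _ fun i _ =>
      Submodule.smul_mem _ _ (Submodule.subset_span ⟨i, rfl⟩)
  · rw [Submodule.span_le]
    rintro _ ⟨k, rfl⟩
    have : x k = ∑ j, U⁻¹ j k • ∑ i, U i j • x i := by
      simp only [Finset.smul_sum, smul_smul]
      rw [Finset.sum_comm]
      have h : ∀ i, ∑ j, (U⁻¹ j k * U i j) • x i = (1 : Matrix (Fin n) (Fin n) R) i k • x i := by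
        intro i
        rw [← Finset.sum_smul, ← Matrix.mul_nonsing_inv U hU, Matrix.mul_apply]
        simp only [mul_comm]
      simp [h, Matrix.one_apply]
    rw [SetLike.mem_coe, this]
    exact Submodule.sum_mem _ fun j _ =>
      Submodule.smul_mem _ _ (Submodule.subset_span ⟨j, rfl⟩)

/-- A subalgebra is the multiplier ring of each of its unit multiples. -/
theorem Subalgebra.eq_of_unit_mul_mem_iff {R A : Type*} [CommRing R] [CommRing A] [Algebra R A]
    {S T : Subalgebra R A} (u : Aˣ) (h : ∀ x, x ∈ S ↔ u * x ∈ T) : S = T := by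
  ext x
  constructor
  · intro hx
    have h1 : (↑u⁻¹ : A) ∈ S := by simp [h]
    simpa [mul_left_comm] using (h _).mp (S.mul_mem hx h1)
  · intro hx
    have h1 : (u : A) ∈ T := by simpa using (h 1).mp S.one_mem
    exact (h x).mpr (T.mul_mem h1 hx)

theorem image_adjoin_int_singleton {A B : Type*} [Ring A] [Ring B] [Algebra ℤ A] [Algebra ℤ B]
    (φ : A →+* B) (x : A) :
    φ '' (Algebra.adjoin ℤ {x} : Set A) = (Algebra.adjoin ℤ {φ x} : Set B) := by
  let ψ : A →ₐ[ℤ] B := { φ with commutes' := fun r => by simp }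
  have := congrArg (fun S : Subalgebra ℤ B => (S : Set B)) (ψ.map_adjoin {x})
  rwa [Set.image_singleton] at this

theorem Polynomial.aeval_int_apply {A B : Type*} [Ring A] [Ring B] [Algebra ℤ A] [Algebra ℤ B]
    (φ : A →+* B) (x : A) (p : ℤ[X]) : aeval (φ x) p = φ (aeval x p) :=
  aeval_algHom_apply ({ φ with commutes' := fun r => by simp } : A →ₐ[ℤ] B) x p

theorem hermiteEquiv_of_equiv_roots {n : ℕ} {f g : ℤ[X]} (hf : f.Monic) (hg : g.Monic)
    (hdf : (f.aroots ℂ).Nodup) (hdg : (g.aroots ℂ).Nodup) {U : Matrix (Fin n) (Fin n) ℤ}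
    (hU : IsUnit U.det) (τ : g.rootSet ℂ ≃ f.rootSet ℂ)
    (h : ∀ z : g.rootSet ℂ, revPow n (z : ℂ) ᵥ* U.map (Int.cast : ℤ → ℂ) = revPow n (τ z : ℂ)) :
    HermiteEquiv n f g := by
  refine ⟨U, 1, hU, Or.inl rfl, ?_⟩
  rw [hermiteForm_eq_prod n hf hdf, hermiteForm_eq_prod n hg hdg, map_prod, Int.cast_one, map_one,
    one_mul]
  refine Fintype.prod_equiv τ _ _ fun z => ?_
  rw [← h]
  exact bind₁_linForm (U.map (Int.cast : ℤ → ℂ)) _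

theorem HermiteEquiv.exists_equiv_roots {n : ℕ} (hn : 2 ≤ n) {f g : ℤ[X]} (hf : f.Monic)
    (hg : g.Monic) (hfn : f.natDegree = n) (hgn : g.natDegree = n)
    (hdf : (f.aroots ℂ).Nodup) (hdg : (g.aroots ℂ).Nodup) (h : HermiteEquiv n f g) :
    ∃ U : Matrix (Fin n) (Fin n) ℤ, IsUnit U.det ∧ ∃ τ : f.rootSet ℂ ≃ g.rootSet ℂ,
      ∀ z, ∃ c : ℂ, c ≠ 0 ∧
        revPow n (τ z : ℂ) ᵥ* U.map (Int.cast : ℤ → ℂ) = c • revPow n (z : ℂ) := by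
  obtain ⟨U, ε, hU, -, h⟩ := h
  refine ⟨U, hU, ?_⟩
  have hb : ∀ z : g.rootSet ℂ, MvPolynomial.bind₁
      (fun i : Fin n => ∑ j : Fin n, MvPolynomial.C ((U i j : ℂ)) * MvPolynomial.X j)
      (linForm (revPow n (z : ℂ))) = linForm (revPow n (z : ℂ) ᵥ* U.map (Int.cast : ℤ → ℂ)) :=
    fun z => bind₁_linForm (U.map (Int.cast : ℤ → ℂ)) _
  rw [hermiteForm_eq_prod n hf hdf, hermiteForm_eq_prod n hg hdg, map_prod] at h
  simp only [hb] at h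
  have key : ∀ z : f.rootSet ℂ, ∃ y : g.rootSet ℂ, ∃ c : ℂ, c ≠ 0 ∧
      revPow n (y : ℂ) ᵥ* U.map (Int.cast : ℤ → ℂ) = c • revPow n (z : ℂ) := by
    intro z
    have hz := revPow_ne_zero hn (z : ℂ)
    have hdvd : linForm (revPow n (z : ℂ)) ∣
        ∏ y : g.rootSet ℂ, linForm (revPow n (y : ℂ) ᵥ* U.map (Int.cast : ℤ → ℂ)) := by
      rw [h]
      exact (Finset.dvd_prod_of_mem _ (Finset.mem_univ z)).mul_left _
    obtain ⟨y, -, hy⟩ := (prime_linForm hz).exists_mem_finset_dvd hdvd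
    exact ⟨y, exists_smul_eq_of_linForm_dvd hz
      (vecMul_ne_zero_of_isUnit_det hU (revPow_ne_zero hn _)) hy⟩
  choose τ hτ using key
  have hinj : Function.Injective τ := by
    intro z w hzw
    obtain ⟨c, hc, h1⟩ := hτ z
    obtain ⟨d, hd, h2⟩ := hτ w
    rw [hzw, h2] at h1
    have hl := congrFun h1 ⟨n - 1, by lia⟩
    have hp := congrFun h1 ⟨n - 2, by lia⟩
    simp only [Pi.smul_apply, revPow_last, revPow_penultimate hn, smul_eq_mul, mul_one] at hl hp
    rw [hl] at hp
    exact Subtype.ext (mul_left_cancel₀ hc hp).symm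
  have hbij : Function.Bijective τ := (Fintype.bijective_iff_injective_and_card τ).mpr
    ⟨hinj, by rw [card_rootSet_of_nodup hf hdf, card_rootSet_of_nodup hg hdg, hfn, hgn]⟩
  exact ⟨Equiv.ofBijective τ hbij, hτ⟩

theorem evalRoot_sum_smul {n : ℕ} (g : ℤ[X]) (U : Matrix (Fin n) (Fin n) ℤ) (z : g.rootSet ℂ)
    (j : Fin n) : evalRoot g z (∑ i, U i j • revPow n (rootOf g) i) =
      (revPow n (z : ℂ) ᵥ* U.map (Int.cast : ℤ → ℂ)) j := by
  simp [Matrix.vecMul, dotProduct, map_revPow, mul_comm]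

theorem isUnit_of_evalRoot_ne_zero {f : ℤ[X]} (hf : f.Monic) (h : (f.aroots ℂ).Nodup) {x : Kf f}
    (hx : ∀ z, evalRoot f z x ≠ 0) : IsUnit x := by
  have : Module.Finite ℚ (Kf f) := (hf.map _).finite_adjoinRoot
  have : IsArtinianRing (Kf f) := IsArtinianRing.of_finite ℚ _
  refine IsArtinianRing.isUnit_of_mem_nonZeroDivisors ?_
  rw [mem_nonZeroDivisors_iff_right]
  intro y hy
  refine eq_of_evalRoot_eq hf h fun z => ?_
  have := congrArg (evalRoot f z) hy
  rw [map_mul, map_zero, mul_eq_zero] at this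
  simpa [hx z] using this

theorem exists_algEquiv_of_equiv_roots {f g : ℤ[X]} (hf : f.Monic) (hg : g.Monic)
    (hfg : f.natDegree = g.natDegree) (hdf : (f.aroots ℂ).Nodup) (hdg : (g.aroots ℂ).Nodup)
    (τ : f.rootSet ℂ ≃ g.rootSet ℂ) {a : Kf g} (ha : ∀ z, evalRoot g (τ z) a = z) :
    ∃ φ : Kf f ≃ₐ[ℚ] Kf g, φ (rootOf f) = a := by
  have ha0 : aeval a f = 0 := by
    refine eq_of_evalRoot_eq hg hdg fun z => ?_
    obtain ⟨y, rfl⟩ := τ.surjective z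
    have := (mem_rootSet'.mp y.2).2
    rw [map_zero, ← this, ← ha y]
    exact (aeval_int_apply (evalRoot g (τ y)).toRingHom a f).symm
  let φ : Kf f →ₐ[ℚ] Kf g := AdjoinRoot.liftAlgHom _ (Algebra.ofId ℚ _) a (by
    rw [Algebra.toRingHom_ofId, eval₂_map, ← ha0, aeval_def]
    congr 1)
  have hφ : φ (rootOf f) = a := AdjoinRoot.liftAlgHom_root ..
  have hev : ∀ z, (evalRoot g (τ z)).comp φ = evalRoot f z := by
    intro z
    refine AdjoinRoot.algHom_ext ?_
    change evalRoot g (τ z) (φ (rootOf f)) = evalRoot f z (rootOf f)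
    rw [hφ, ha, evalRoot_rootOf]
  have hinj : Function.Injective φ := fun x y hxy =>
    eq_of_evalRoot_eq hf hdf fun z => by
      rw [← hev, AlgHom.comp_apply, AlgHom.comp_apply, hxy]
  have : Module.Finite ℚ (Kf f) := (hf.map _).finite_adjoinRoot
  have : Module.Finite ℚ (Kf g) := (hg.map _).finite_adjoinRoot
  have hrank : ∀ {p : ℤ[X]}, p.Monic → Module.finrank ℚ (Kf p) = p.natDegree := fun {p} hp => by
    rw [(AdjoinRoot.powerBasis (hp.map (Int.castRingHom ℚ)).ne_zero).finrank,
      AdjoinRoot.powerBasis_dim, hp.natDegree_map]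
  have hsurj : Function.Surjective φ :=
    (LinearMap.injective_iff_surjective_of_finrank_eq_finrank (f := φ.toLinearMap)
      (by rw [hrank hf, hrank hg, hfg])).mp hinj
  exact ⟨AlgEquiv.ofBijective φ ⟨hinj, hsurj⟩, hφ⟩

theorem HermiteEquiv.exists_algEquiv {n : ℕ} (hn : 2 ≤ n) {f g : ℤ[X]} (hf : f.Monic)
    (hg : g.Monic) (hfn : f.natDegree = n) (hgn : g.natDegree = n)
    (hdf : (f.aroots ℂ).Nodup) (hdg : (g.aroots ℂ).Nodup) (h : HermiteEquiv n f g) :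
    ∃ φ : Kf f ≃ₐ[ℚ] Kf g,
      φ '' (Algebra.adjoin ℤ {rootOf f} : Set (Kf f)) =
        (Algebra.adjoin ℤ {rootOf g} : Set (Kf g)) := by
  have hn1 : n - 1 < n := by lia
  have hn2 : n - 2 < n := by lia
  obtain ⟨U, hU, τ, hτ⟩ := h.exists_equiv_roots hn hf hg hfn hgn hdf hdg
  choose c hc hτ using hτ
  set w : Fin n → Kf g := fun j => ∑ i, U i j • revPow n (rootOf g) i with hw
  have hev : ∀ z j, evalRoot g (τ z) (w j) = c z * revPow n (z : ℂ) j := fun z j => by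
    rw [hw, evalRoot_sum_smul, hτ, Pi.smul_apply, smul_eq_mul]
  have hev_last : ∀ z, evalRoot g (τ z) (w ⟨n - 1, hn1⟩) = c z := fun z => by
    rw [hev, revPow_last, mul_one]
  obtain ⟨u, hu⟩ : IsUnit (w ⟨n - 1, hn1⟩) := by
    refine isUnit_of_evalRoot_ne_zero hg hdg fun z => ?_
    obtain ⟨y, rfl⟩ := τ.surjective z
    rw [hev_last]
    exact hc y
  rw [← hu] at hev_last
  set a : Kf g := ↑u⁻¹ * w ⟨n - 2, hn2⟩ with ha
  have hua : ↑u * a = w ⟨n - 2, hn2⟩ := u.mul_inv_cancel_left _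
  have hev_a : ∀ z, evalRoot g (τ z) a = z := fun z => by
    have := congrArg (evalRoot g (τ z)) hua
    rw [map_mul, hev_last, hev, revPow_penultimate hn] at this
    exact mul_left_cancel₀ (hc z) this
  have hwa : w = fun j => ↑u * revPow n a j := by
    ext1 j
    refine eq_of_evalRoot_eq hg hdg fun z => ?_
    obtain ⟨y, rfl⟩ := τ.surjective z
    rw [hev, map_mul, hev_last, map_revPow, hev_a]
  obtain ⟨φ, hφ⟩ := exists_algEquiv_of_equiv_roots hf hg (hfn.trans hgn.symm) hdf hdg τ hev_a
  refine ⟨φ, ?_⟩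
  have himg := image_adjoin_int_singleton (φ : Kf f →+* Kf g) (rootOf f)
  refine himg.trans ?_
  have hφ' : (φ : Kf f →+* Kf g) (rootOf f) = a := hφ
  rw [hφ']
  have ha0 : aeval a f = 0 := by
    rw [← hφ', aeval_int_apply, aeval_rootOf, map_zero]
  have hspan : Submodule.span ℤ (Set.range w) =
      Subalgebra.toSubmodule (Algebra.adjoin ℤ {rootOf g}) := by
    rw [← span_revPow hg (aeval_rootOf g), hgn]
    exact span_range_sum_smul hU _
  congr 1
  refine Subalgebra.eq_of_unit_mul_mem_iff u fun x => ?_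
  rw [← Subalgebra.mem_toSubmodule, ← Subalgebra.mem_toSubmodule, ← hspan,
    ← span_revPow hf ha0, hfn, hwa]
  have hmap : Submodule.span ℤ (Set.range fun j => ↑u * revPow n a j) =
      (Submodule.span ℤ (Set.range (revPow n a))).map (LinearMap.mulLeft ℤ (u : Kf g)) := by
    rw [Submodule.map_span, ← Set.range_comp]
    rfl
  rw [hmap]
  constructor
  · exact fun hx => ⟨x, hx, rfl⟩
  · rintro ⟨y, hy, hyx⟩
    exact u.isUnit.mul_left_cancel hyx ▸ hy

theorem exists_matrix_of_range_subset_span {R M : Type*} [CommRing R] [AddCommGroup M] [Module R M]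
    {n : ℕ} {x y : Fin n → M} (h : Set.range y ⊆ Submodule.span R (Set.range x)) :
    ∃ U : Matrix (Fin n) (Fin n) R, ∀ j, y j = ∑ i, U i j • x i := by
  have : ∀ j, ∃ c : Fin n → R, ∑ i, c i • x i = y j := fun j =>
    (Submodule.mem_span_range_iff_exists_fun R).mp (h ⟨j, rfl⟩)
  choose c hc using this
  exact ⟨Matrix.of fun i j => c j i, fun j => (hc j).symm⟩

theorem exists_isUnit_det_of_span_eq {R M : Type*} [CommRing R] [AddCommGroup M] [Module R M]
    {n : ℕ} {x y : Fin n → M} (hx : LinearIndependent R x)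
    (h : Submodule.span R (Set.range y) = Submodule.span R (Set.range x)) :
    ∃ U : Matrix (Fin n) (Fin n) R, IsUnit U.det ∧ ∀ j, y j = ∑ i, U i j • x i := by
  obtain ⟨U, hU⟩ := exists_matrix_of_range_subset_span (h ▸ Submodule.subset_span)
  obtain ⟨V, hV⟩ := exists_matrix_of_range_subset_span (h.symm ▸ Submodule.subset_span)
  refine ⟨U, ?_, hU⟩
  have hUV : U * V = 1 := by
    ext k j
    have hj : ∑ k, (U * V) k j • x k = ∑ k, (1 : Matrix (Fin n) (Fin n) R) k j • x k := by
      simp only [Matrix.one_apply, ite_smul, one_smul, zero_smul, Finset.sum_ite_eq',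
        Finset.mem_univ, if_true]
      conv_rhs => rw [hV j]
      simp only [hU, Finset.smul_sum, smul_smul, Matrix.mul_apply, Finset.sum_smul]
      rw [Finset.sum_comm]
      simp only [mul_comm]
    exact Fintype.linearIndependent_iffₛ.mp hx _ _ hj k
  exact IsUnit.of_mul_eq_one V.det (by rw [← Matrix.det_mul, hUV, Matrix.det_one])

theorem hermiteEquiv_of_algEquiv {n : ℕ} {f g : ℤ[X]} (hf : f.Monic)
    (hg : g.Monic) (hfn : f.natDegree = n) (hgn : g.natDegree = n)
    (hdf : (f.aroots ℂ).Nodup) (hdg : (g.aroots ℂ).Nodup) (φ : Kf f ≃ₐ[ℚ] Kf g)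
    (hφ : φ '' (Algebra.adjoin ℤ {rootOf f} : Set (Kf f)) =
      (Algebra.adjoin ℤ {rootOf g} : Set (Kf g))) :
    HermiteEquiv n f g := by
  have h0 : aeval (φ (rootOf f)) f = 0 := by
    have := aeval_int_apply (φ : Kf f →+* Kf g) (rootOf f) f
    rwa [aeval_rootOf, map_zero] at this
  have hadj : Algebra.adjoin ℤ {φ (rootOf f)} = Algebra.adjoin ℤ {rootOf g} :=
    SetLike.coe_injective
      ((image_adjoin_int_singleton (φ : Kf f →+* Kf g) (rootOf f)).symm.trans hφ)
  have hspan : Submodule.span ℤ (Set.range (revPow n (φ (rootOf f)))) =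
      Submodule.span ℤ (Set.range (revPow n (rootOf g))) := by
    have h1 := span_revPow hf h0
    have h2 := span_revPow hg (aeval_rootOf g)
    rw [hfn] at h1
    rw [hgn] at h2
    rw [h1, h2, hadj]
  obtain ⟨U, hU, hUφ⟩ :=
    exists_isUnit_det_of_span_eq (hgn ▸ linearIndependent_revPow_rootOf hg) hspan
  let τ : g.rootSet ℂ → f.rootSet ℂ := fun z => ⟨evalRoot g z (φ (rootOf f)), by
    rw [mem_rootSet_of_ne hf.ne_zero]
    have := aeval_int_apply (evalRoot g z).toRingHom (φ (rootOf f)) f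
    rwa [h0, map_zero] at this⟩
  have hinj : Function.Injective τ := by
    intro y z hyz
    have hcomp : (evalRoot g y).comp (φ : Kf f →ₐ[ℚ] Kf g) =
        (evalRoot g z).comp (φ : Kf f →ₐ[ℚ] Kf g) :=
      AdjoinRoot.algHom_ext (congrArg Subtype.val hyz)
    have := DFunLike.congr_fun hcomp (φ.symm (rootOf g))
    simpa [Subtype.ext_iff] using this
  have hbij : Function.Bijective τ := (Fintype.bijective_iff_injective_and_card τ).mpr
    ⟨hinj, by rw [card_rootSet_of_nodup hf hdf, card_rootSet_of_nodup hg hdg, hfn, hgn]⟩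
  refine hermiteEquiv_of_equiv_roots hf hg hdf hdg hU (Equiv.ofBijective τ hbij) fun z => ?_
  ext j
  rw [← evalRoot_sum_smul, ← hUφ, map_revPow]
  rfl

/-- monic `f, g` (degree `n ≥ 2`, nonzero discriminant) are Hermite
equivalent iff there is a ℚ-algebra isomorphism `φ : K_f ≃ K_g` mapping `ℤ[α]`
onto `ℤ[β]`. -/
theorem hermiteEquiv_iff_monic (n : ℕ) (hn : 2 ≤ n) (f g : Polynomial ℤ)
    (hfm : f.Monic) (hgm : g.Monic)
    (hfn : f.natDegree = n) (hgn : g.natDegree = n)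
    (hdf : discC f ≠ 0) (hdg : discC g ≠ 0) :
    HermiteEquiv n f g ↔
      ∃ φ : Kf f ≃ₐ[ℚ] Kf g,
        φ '' (Algebra.adjoin ℤ {rootOf f} : Set (Kf f)) =
          (Algebra.adjoin ℤ {rootOf g} : Set (Kf g)) := by
  have hf := nodup_roots_of_discC_ne_zero hdf
  have hg := nodup_roots_of_discC_ne_zero hdg
  exact ⟨fun h => h.exists_algEquiv hn hfm hgm hfn hgn hf hg,
    fun ⟨φ, hφ⟩ => hermiteEquiv_of_algEquiv hfm hgm hfn hgn hf hg φ hφ⟩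
end

section
/- Let f(X) = 4X⁴ − X³ − 62X² + 13X + 255 and g(X) = 5X⁴ − X³ − 2X² − 7X − 6 in ℤ[X]. Then: (a) there exists a ℚ-algebra isomorphism φ : K_f → K_g with φ(R_f) = R_g; (b) the invariant ideal I_f is principal, i.e. there exists κ ∈ K_f^× with I_f = {κ·x : x ∈ R_f}; and (c) the invariant ideal I_g is not principal, i.e. for every κ ∈ K_g^× one has I_g ≠ {κ·x : x ∈ R_g}. In particular, there is no isomorphism between R_f and R_g under which the ideal classes of I_f and I_g are identified. -/
open Polynomial

namespace QuarticExample

open Pointwise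

/-! ### Invariant modules of quartic polynomials -/

lemma coeffs_of_eq {f : ℤ[X]} {a b c d e : ℤ}
    (hf : f = C a * X ^ 4 + C b * X ^ 3 + C c * X ^ 2 + C d * X + C e) :
    f.coeff 4 = a ∧ f.coeff 3 = b ∧ f.coeff 2 = c := by
  subst hf
  simp [-eq_intCast, coeff_X_pow]

lemma natDegree_of_eq {f : ℤ[X]} {a b c d e : ℤ} (ha : a ≠ 0)
    (hf : f = C a * X ^ 4 + C b * X ^ 3 + C c * X ^ 2 + C d * X + C e) : f.natDegree = 4 := by
  subst hf
  compute_degree!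

lemma zeta_of_eq {f : ℤ[X]} {a b c d e : ℤ} (ha : a ≠ 0)
    (hf : f = C a * X ^ 4 + C b * X ^ 3 + C c * X ^ 2 + C d * X + C e) :
    zeta f 1 = a * rootOf f ∧ zeta f 2 = a * rootOf f ^ 2 + b * rootOf f ∧
      zeta f 3 = a * rootOf f ^ 3 + b * rootOf f ^ 2 + c * rootOf f := by
  obtain ⟨h4, h3, h2⟩ := coeffs_of_eq hf
  simp [zeta, Finset.sum_range_succ, natDegree_of_eq ha hf, h4, h3, h2]

lemma aeval_rootOf (f : ℤ[X]) : aeval (rootOf f) f = 0 := by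
  rw [← aeval_map_algebraMap ℚ]
  exact AdjoinRoot.eval₂_root _

lemma rootOf_relation {f : ℤ[X]} {a b c d e : ℤ}
    (hf : f = C a * X ^ 4 + C b * X ^ 3 + C c * X ^ 2 + C d * X + C e) :
    (a : Kf f) * rootOf f ^ 4 + b * rootOf f ^ 3 + c * rootOf f ^ 2 + d * rootOf f + e = 0 := by
  have h := aeval_rootOf f
  conv at h => lhs; arg 2; rw [hf]
  simpa only [map_add, map_mul, map_pow, aeval_X, eq_intCast, map_intCast] using h

lemma mem_span_four {M : Type*} [AddCommGroup M] {w x y z v : M} :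
    v ∈ Submodule.span ℤ {w, x, y, z} ↔
      ∃ c₀ c₁ c₂ c₃ : ℤ, v = c₀ • w + c₁ • x + c₂ • y + c₃ • z := by
  simp only [Submodule.mem_span_insert, Submodule.mem_span_singleton]
  constructor
  · rintro ⟨c₀, _, ⟨c₁, _, ⟨c₂, _, ⟨c₃, rfl⟩, rfl⟩, rfl⟩, rfl⟩
    exact ⟨c₀, c₁, c₂, c₃, by abel⟩
  · rintro ⟨c₀, c₁, c₂, c₃, rfl⟩
    exact ⟨c₀, _, ⟨c₁, _, ⟨c₂, _, ⟨c₃, rfl⟩, rfl⟩, rfl⟩, by abel⟩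

lemma mem_invModule_zero {f : ℤ[X]} (hf : f.natDegree = 4) {v : Kf f} :
    v ∈ invModule f 0 ↔
      ∃ c₀ c₁ c₂ c₃ : ℤ, v = c₀ + c₁ * zeta f 1 + c₂ * zeta f 2 + c₃ * zeta f 3 := by
  have : ({x | ∃ j ≤ 0, x = rootOf f ^ j} ∪
      {x | ∃ i, 0 + 1 ≤ i ∧ i ≤ f.natDegree - 1 ∧ x = zeta f i} : Set (Kf f)) =
      {1, zeta f 1, zeta f 2, zeta f 3} := by
    ext x
    simp only [hf, Set.mem_union, Set.mem_ofPred_eq, Set.mem_insert_iff, Set.mem_singleton_iff]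
    constructor
    · rintro (⟨j, hj, rfl⟩ | ⟨i, h1, h2, rfl⟩)
      · interval_cases j; simp
      · interval_cases i <;> simp
    · rintro (rfl | rfl | rfl | rfl)
      · exact .inl ⟨0, le_rfl, by simp⟩
      · exact .inr ⟨1, by simp⟩
      · exact .inr ⟨2, by simp⟩
      · exact .inr ⟨3, by simp⟩
  rw [invModule, this, mem_span_four]
  simp only [zsmul_eq_mul, mul_one]

lemma mem_invModule_one {f : ℤ[X]} (hf : f.natDegree = 4) {v : Kf f} :
    v ∈ invModule f 1 ↔
      ∃ c₀ c₁ c₂ c₃ : ℤ, v = c₀ + c₁ * rootOf f + c₂ * zeta f 2 + c₃ * zeta f 3 := by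
  have : ({x | ∃ j ≤ 1, x = rootOf f ^ j} ∪
      {x | ∃ i, 1 + 1 ≤ i ∧ i ≤ f.natDegree - 1 ∧ x = zeta f i} : Set (Kf f)) =
      {1, rootOf f, zeta f 2, zeta f 3} := by
    ext x
    simp only [hf, Set.mem_union, Set.mem_ofPred_eq, Set.mem_insert_iff, Set.mem_singleton_iff]
    constructor
    · rintro (⟨j, hj, rfl⟩ | ⟨i, h1, h2, rfl⟩)
      · interval_cases j <;> simp
      · interval_cases i <;> simp
    · rintro (rfl | rfl | rfl | rfl)
      · exact .inl ⟨0, by simp⟩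
      · exact .inl ⟨1, by simp⟩
      · exact .inr ⟨2, by simp⟩
      · exact .inr ⟨3, by simp⟩
  rw [invModule, this, mem_span_four]
  simp only [zsmul_eq_mul, mul_one]

lemma intCast_mul_cancel {A : Type*} [Ring A] [Algebra ℚ A] {n : ℤ} (hn : n ≠ 0) {x y : A}
    (h : (n : A) * x = n * y) : x = y := by
  have key : ((n⁻¹ : ℚ) • (n : A)) = 1 := by
    rw [← map_intCast (algebraMap ℚ A), Algebra.smul_def, ← map_mul]
    simp [hn]
  calc x = ((n⁻¹ : ℚ) • (n : A)) * x := by rw [key, one_mul]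
    _ = ((n⁻¹ : ℚ) • (n : A)) * y := by rw [smul_mul_assoc, h, smul_mul_assoc]
    _ = y := by rw [key, one_mul]

lemma intCast_mul_inv_smul {A : Type*} [Ring A] [Algebra ℚ A] {n : ℤ} (hn : n ≠ 0) (x : A) :
    (n : A) * ((n⁻¹ : ℚ) • x) = x := by
  rw [← map_intCast (algebraMap ℚ A), Algebra.mul_smul_comm, Algebra.smul_def, ← mul_assoc,
    ← map_mul]
  simp [hn]

section Isomorphism

variable {f g : ℤ[X]}
  (hf : f = C 4 * X ^ 4 + C (-1) * X ^ 3 + C (-62) * X ^ 2 + C 13 * X + C 255)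
  (hg : g = C 5 * X ^ 4 + C (-1) * X ^ 3 + C (-2) * X ^ 2 + C (-7) * X + C (-6))

/-- The image in `K_g` of the residue class of `X` in `K_f`. -/
noncomputable def imageF (g : ℤ[X]) : Kf g :=
  (4 : ℚ)⁻¹ • (-3 - 11 * rootOf g ^ 2 + 5 * rootOf g ^ 3)

/-- The image in `K_f` of the residue class of `X` in `K_g`. -/
noncomputable def imageG (f : ℤ[X]) : Kf f :=
  (5 : ℚ)⁻¹ • (171 - 59 * rootOf f - 22 * rootOf f ^ 2 + 8 * rootOf f ^ 3)

lemma four_mul_imageF :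
    4 * imageF g = -3 - 11 * rootOf g ^ 2 + 5 * rootOf g ^ 3 := by
  have := intCast_mul_inv_smul (n := 4) (by norm_num)
    (-3 - 11 * rootOf g ^ 2 + 5 * rootOf g ^ 3)
  simpa only [imageF, Int.cast_ofNat] using this

lemma five_mul_imageG :
    5 * imageG f = 171 - 59 * rootOf f - 22 * rootOf f ^ 2 + 8 * rootOf f ^ 3 := by
  have := intCast_mul_inv_smul (n := 5) (by norm_num)
    (171 - 59 * rootOf f - 22 * rootOf f ^ 2 + 8 * rootOf f ^ 3)
  simpa only [imageG, Int.cast_ofNat] using this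

include hf in
lemma relation_f : 4 * rootOf f ^ 4 - rootOf f ^ 3 - 62 * rootOf f ^ 2 + 13 * rootOf f + 255
    = 0 := by
  have := rootOf_relation hf
  push_cast at this
  linear_combination this

include hg in
lemma relation_g : 5 * rootOf g ^ 4 - rootOf g ^ 3 - 2 * rootOf g ^ 2 - 7 * rootOf g - 6 = 0 := by
  have := rootOf_relation hg
  push_cast at this
  linear_combination this

include hg in
lemma eval_imageF : 4 * imageF g ^ 4 - imageF g ^ 3 - 62 * imageF g ^ 2 + 13 * imageF g + 255
    = 0 := by
  have h := relation_g hg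
  have hb := four_mul_imageF (g := g)
  set b := imageF g
  set a := rootOf g
  have key : (4 * b) ^ 4 - (4 * b) ^ 3 - 248 * (4 * b) ^ 2 + 208 * (4 * b) + 16320 = 0 := by
    rw [hb]
    linear_combination (- 2262 * a ^ 0 + 2639 * a ^ 1 + 537 * a ^ 2 - 2430 * a ^ 3
      + 4062 * a ^ 4 - 5211 * a ^ 5 + 3465 * a ^ 6 - 1075 * a ^ 7 + 125 * a ^ 8) * h
  apply intCast_mul_cancel (n := 64) (by norm_num)
  push_cast
  linear_combination key

include hf in
lemma eval_imageG : 5 * imageG f ^ 4 - imageG f ^ 3 - 2 * imageG f ^ 2 - 7 * imageG f - 6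
    = 0 := by
  have h := relation_f hf
  have hb := five_mul_imageG (f := f)
  set b := imageG f
  set a := rootOf f
  have key : (5 * b) ^ 4 - (5 * b) ^ 3 - 10 * (5 * b) ^ 2 - 175 * (5 * b) - 750 = 0 := by
    rw [hb]
    linear_combination (3332207 * a ^ 0 - 4776395 * a ^ 1 + 1723872 * a ^ 2 + 619168 * a ^ 3
      - 566816 * a ^ 4 + 84848 * a ^ 5 + 29376 * a ^ 6 - 11008 * a ^ 7 + 1024 * a ^ 8) * h
  apply intCast_mul_cancel (n := 125) (by norm_num)
  push_cast
  linear_combination key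

lemma exists_algHom {A : Type*} [CommRing A] [Algebra ℚ A] (f : ℤ[X]) (b : A)
    (hb : aeval b f = 0) : ∃ φ : Kf f →ₐ[ℚ] A, φ (rootOf f) = b := by
  refine ⟨AdjoinRoot.liftAlgHom _ (Algebra.ofId ℚ A) b ?_, AdjoinRoot.liftAlgHom_root ..⟩
  have : ((Algebra.ofId ℚ A : ℚ →ₐ[ℚ] A) : ℚ →+* A).comp (Int.castRingHom ℚ)
    = algebraMap ℤ A := RingHom.ext_int _ _
  rw [eval₂_map, ← hb, aeval_def]
  exact congrArg (fun i => eval₂ i b f) this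

include hf hg in
lemma exists_algEquiv : ∃ φ : Kf f ≃ₐ[ℚ] Kf g,
    φ (rootOf f) = imageF g ∧ φ.symm (rootOf g) = imageG f := by
  have hF : aeval (imageF g) f = 0 := by
    conv_lhs => rw [hf]
    simp only [map_add, map_mul, map_pow, aeval_X, eq_intCast, map_intCast]
    push_cast
    linear_combination eval_imageF hg
  have hG : aeval (imageG f) g = 0 := by
    conv_lhs => rw [hg]
    simp only [map_add, map_mul, map_pow, aeval_X, eq_intCast, map_intCast]
    push_cast
    linear_combination eval_imageG hf
  obtain ⟨φ, hφ⟩ := exists_algHom f _ hF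
  obtain ⟨ψ, hψ⟩ := exists_algHom g _ hG
  refine ⟨AlgEquiv.ofAlgHom φ ψ ?_ ?_, hφ, hψ⟩
  · apply AdjoinRoot.algHom_ext
    change φ (ψ (rootOf g)) = rootOf g
    have h := relation_g hg
    have h4 := four_mul_imageF (g := g)
    have h5 := congrArg φ (five_mul_imageG (f := f))
    simp only [map_add, map_sub, map_mul, map_pow, map_ofNat, hφ] at h5
    rw [hψ]
    set a := rootOf g
    set b := imageF g
    apply intCast_mul_cancel (n := 40) (by norm_num)
    have key : (4 * b) ^ 3 - 11 * (4 * b) ^ 2 - 118 * (4 * b) + 1368 = 40 * a := by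
      rw [h4]
      linear_combination (- 266 * a ^ 0 + 317 * a ^ 1 - 327 * a ^ 2 + 341 * a ^ 3 - 160 * a ^ 4
        + 25 * a ^ 5) * h
    push_cast
    linear_combination 8 * h5 + key
  · apply AdjoinRoot.algHom_ext
    change ψ (φ (rootOf f)) = rootOf f
    have h := relation_f hf
    have h4 := five_mul_imageG (f := f)
    have h5 := congrArg ψ (four_mul_imageF (g := g))
    simp only [map_add, map_sub, map_mul, map_pow, map_ofNat, map_neg, hψ] at h5
    rw [hφ]
    set a := rootOf f
    set b := imageG f
    apply intCast_mul_cancel (n := 100) (by norm_num)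
    have key : (5 * b) ^ 3 - 11 * (5 * b) ^ 2 - 75 = 100 * a := by
      rw [h4]
      linear_combination (18347 * a ^ 0 - 20362 * a ^ 1 + 5108 * a ^ 2 + 1800 * a ^ 3
        - 1024 * a ^ 4 + 128 * a ^ 5) * h
    push_cast
    linear_combination 25 * h5 + key

include hf hg in
lemma image_invModule_zero (φ : Kf f ≃ₐ[ℚ] Kf g) (hφ : φ (rootOf f) = imageF g)
    (hφ' : φ.symm (rootOf g) = imageG f) :
    φ '' (invModule f 0 : Set (Kf f)) = (invModule g 0 : Set (Kf g)) := by
  have df := natDegree_of_eq (by norm_num) hf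
  have dg := natDegree_of_eq (by norm_num) hg
  obtain ⟨f1, f2, f3⟩ := zeta_of_eq (by norm_num) hf
  obtain ⟨g1, g2, g3⟩ := zeta_of_eq (by norm_num) hg
  have rf := relation_f hf
  have rg := relation_g hg
  have hb := four_mul_imageF (g := g)
  have hc := five_mul_imageG (f := f)
  push_cast at f1 f2 f3 g1 g2 g3
  set a := rootOf g
  set b := imageF g
  set a' := rootOf f
  set c := imageG f
  have φ1 : φ (zeta f 1) = -3 - 2 * zeta g 2 + zeta g 3 := by
    rw [f1, g2, g3]
    simp only [map_mul, map_ofNat, hφ]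
    linear_combination hb
  have φ2 : φ (zeta f 2) = 36 + zeta g 1 - zeta g 3 := by
    rw [f2, g1, g3]
    simp only [map_mul, map_add, map_neg, map_one, map_pow, map_ofNat, hφ]
    apply intCast_mul_cancel (n := 4) (by norm_num)
    have key : (4 * b) ^ 2 - 4 * b = 4 * (36 + 5 * a - (5 * a ^ 3 - a ^ 2 - 2 * a)) := by
      rw [hb]
      linear_combination (22 * a ^ 0 - 21 * a ^ 1 + 5 * a ^ 2) * rg
    push_cast
    linear_combination key
  have φ3 : φ (zeta f 3) = 27 + 3 * zeta g 1 + 15 * zeta g 2 - 10 * zeta g 3 := by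
    rw [f3, g1, g2, g3]
    simp only [map_mul, map_add, map_neg, map_one, map_pow, map_ofNat, hφ]
    apply intCast_mul_cancel (n := 16) (by norm_num)
    have key : (4 * b) ^ 3 - (4 * b) ^ 2 - 248 * (4 * b) =
        16 * (27 + 3 * (5 * a) + 15 * (5 * a ^ 2 - a) - 10 * (5 * a ^ 3 - a ^ 2 - 2 * a)) := by
      rw [hb]
      linear_combination (- 46 * a ^ 0 + 107 * a ^ 1 - 277 * a ^ 2 + 341 * a ^ 3 - 160 * a ^ 4
        + 25 * a ^ 5) * rg
    push_cast
    linear_combination key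
  have ψ1 : φ.symm (zeta g 1) = 171 + 15 * zeta f 1 - 5 * zeta f 2 + 2 * zeta f 3 := by
    rw [g1, f1, f2, f3]
    simp only [map_mul, map_ofNat, hφ']
    linear_combination hc
  have ψ2 : φ.symm (zeta g 2) = 102 + 7 * zeta f 1 - 3 * zeta f 2 + zeta f 3 := by
    rw [g2, f1, f2, f3]
    simp only [map_mul, map_add, map_neg, map_one, map_pow, map_ofNat, hφ']
    apply intCast_mul_cancel (n := 5) (by norm_num)
    have key : (5 * c) ^ 2 - 5 * c = 5 * (102 + 7 * (4 * a') - 3 * (4 * a' ^ 2 - a')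
        + (4 * a' ^ 3 - a' ^ 2 - 62 * a')) := by
      rw [hc]
      linear_combination (112 * a' ^ 0 - 84 * a' ^ 1 + 16 * a' ^ 2) * rf
    push_cast
    linear_combination key
  have ψ3 : φ.symm (zeta g 3) = 207 + 15 * zeta f 1 - 6 * zeta f 2 + 2 * zeta f 3 := by
    rw [g3, f1, f2, f3]
    simp only [map_mul, map_add, map_neg, map_one, map_pow, map_ofNat, hφ']
    apply intCast_mul_cancel (n := 25) (by norm_num)
    have key : (5 * c) ^ 3 - (5 * c) ^ 2 - 10 * (5 * c) =
        25 * (207 + 15 * (4 * a') - 6 * (4 * a' ^ 2 - a')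
          + 2 * (4 * a' ^ 3 - a' ^ 2 - 62 * a')) := by
      rw [hc]
      linear_combination (19467 * a' ^ 0 - 21202 * a' ^ 1 + 5268 * a' ^ 2 + 1800 * a' ^ 3
        - 1024 * a' ^ 4 + 128 * a' ^ 5) * rf
    push_cast
    linear_combination key
  ext y
  constructor
  · rintro ⟨x, hx, rfl⟩
    obtain ⟨c₀, c₁, c₂, c₃, rfl⟩ := (mem_invModule_zero df).1 hx
    refine (mem_invModule_zero dg).2
      ⟨c₀ - 3 * c₁ + 36 * c₂ + 27 * c₃, c₂ + 3 * c₃, -2 * c₁ + 15 * c₃, c₁ - c₂ - 10 * c₃, ?_⟩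
    simp only [map_add, map_mul, map_intCast, φ1, φ2, φ3]
    push_cast
    ring
  · intro hy
    refine ⟨φ.symm y, ?_, φ.apply_symm_apply y⟩
    obtain ⟨c₀, c₁, c₂, c₃, rfl⟩ := (mem_invModule_zero dg).1 hy
    refine (mem_invModule_zero df).2
      ⟨c₀ + 171 * c₁ + 102 * c₂ + 207 * c₃, 15 * c₁ + 7 * c₂ + 15 * c₃,
        -5 * c₁ - 3 * c₂ - 6 * c₃, 2 * c₁ + c₂ + 2 * c₃, ?_⟩
    simp only [map_add, map_mul, map_intCast, ψ1, ψ2, ψ3]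
    push_cast
    ring

end Isomorphism

/-! ### The invariant ideal of `f` is principal -/

lemma exists_invModule_one_eq_smul {f : ℤ[X]}
    (hf : f = C 4 * X ^ 4 + C (-1) * X ^ 3 + C (-62) * X ^ 2 + C 13 * X + C 255) :
    ∃ κ : (Kf f)ˣ,
      (invModule f 1 : Set (Kf f)) = (κ : Kf f) • (invModule f 0 : Set (Kf f)) := by
  have df := natDegree_of_eq (by norm_num) hf
  obtain ⟨f1, f2, f3⟩ := zeta_of_eq (by norm_num) hf
  have rf := relation_f hf
  push_cast at f1 f2 f3
  set a := rootOf f with ha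
  have inv : (371 - 116 * a - 48 * a ^ 2 + 16 * a ^ 3) * (11 + 4 * a) = 1 := by
    linear_combination 16 * rf
  refine ⟨⟨_, _, inv, by rw [mul_comm, inv]⟩, ?_⟩
  ext y
  rw [Set.mem_smul_set, SetLike.mem_coe]
  dsimp only
  constructor
  · intro hy
    refine ⟨(11 + 4 * a) * y, ?_, by rw [smul_eq_mul, ← mul_assoc, inv, one_mul]⟩
    obtain ⟨c₀, c₁, c₂, c₃, rfl⟩ := (mem_invModule_one df).1 hy
    refine (mem_invModule_zero df).2 ⟨11 * c₀ - 1020 * c₃, c₀ + 3 * c₁ + 62 * c₂ - 13 * c₃,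
      c₁ + 11 * c₂, 4 * c₂ + 11 * c₃, ?_⟩
    rw [← ha, f1, f2, f3]
    push_cast
    linear_combination 4 * c₃ * rf
  · rintro ⟨x, hx, rfl⟩
    obtain ⟨c₀, c₁, c₂, c₃, rfl⟩ := (mem_invModule_zero df).1 hx
    refine (mem_invModule_one df).2
      ⟨371 * c₀ - 4080 * c₁ + 12240 * c₂ + 29580 * c₃,
        121 * c₀ - 1331 * c₁ + 3994 * c₂ + 9647 * c₃,
        -11 * c₀ + 121 * c₁ - 363 * c₂ - 877 * c₃,
        4 * c₀ - 44 * c₁ + 132 * c₂ + 319 * c₃, ?_⟩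
    rw [← ha, f1, f2, f3, smul_eq_mul]
    push_cast
    linear_combination (16 * c₁ + (- 48 + 16 * a) * c₂ +
      (- 116 - 48 * a + 16 * a ^ 2) * c₃) * rf

/-! ### Squares in finitely generated commutative groups -/

lemma exists_isSquare_prod_of_card_lt {G ι : Type*} [CommGroup G] [Fintype ι] {n : ℕ}
    (hn : Fintype.card ι < n) (t : ι → G) (e : Fin n → ι → ℤ) :
    ∃ s : Finset (Fin n), s.Nonempty ∧ IsSquare (∏ i ∈ s, ∏ j, t j ^ e i j) := by
  have hdep : ¬ LinearIndependent (ZMod 2) fun i j ↦ (e i j : ZMod 2) := fun h ↦ by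
    have := h.fintype_card_le_finrank
    simp only [Fintype.card_fin, Module.finrank_fintype_fun_eq_card] at this
    omega
  obtain ⟨c, hc, i, hi⟩ := Fintype.not_linearIndependent_iff.1 hdep
  refine ⟨Finset.univ.filter (c · ≠ 0), ⟨i, by simpa using hi⟩, ?_⟩
  rw [Finset.prod_comm]
  refine Finset.isSquare_prod _ fun j _ ↦ ?_
  have hprod (s : Finset (Fin n)) : ∏ i ∈ s, t j ^ e i j = t j ^ ∑ i ∈ s, e i j :=
    (map_prod (zpowersHom G (t j)) (fun i ↦ Multiplicative.ofAdd (e i j)) s).symm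
  rw [hprod]
  refine Even.isSquare_zpow ?_ _
  rw [even_iff_two_dvd, ← Nat.cast_two, ← ZMod.intCast_zmod_eq_zero_iff_dvd]
  rw [Int.cast_sum, Finset.sum_filter]
  refine Eq.trans ?_ (congrFun hc j)
  rw [Finset.sum_apply]
  refine Finset.sum_congr rfl fun k _ ↦ ?_
  have : ∀ a : ZMod 2, a = 0 ∨ a = 1 := by decide
  rcases this (c k) with h | h <;> simp [h]

open NumberField in
lemma exists_isSquare_prod_units {K : Type*} [Field K] [NumberField K] {n : ℕ}
    (hn : Units.rank K + 1 < n) (u : Fin n → (𝓞 K)ˣ) :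
    ∃ s : Finset (Fin n), s.Nonempty ∧ IsSquare (∏ i ∈ s, u i) := by
  obtain ⟨τ, hτ⟩ := IsCyclic.exists_generator (α := Units.torsion K)
  have hu (i) : ∃ e : Option (Fin (Units.rank K)) → ℤ,
      u i = ∏ j, (j.elim (τ : (𝓞 K)ˣ) (Units.fundSystem K)) ^ e j := by
    obtain ⟨⟨z, e⟩, h, -⟩ := Units.exist_unique_eq_mul_prod K (u i)
    obtain ⟨m, hm⟩ := Subgroup.mem_zpowers_iff.1 (hτ z)
    refine ⟨fun j ↦ j.elim m e, ?_⟩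
    rw [Fintype.prod_option, h, ← hm]
    simp
  choose e he using hu
  simpa only [← he] using exists_isSquare_prod_of_card_lt (n := n) (by simpa using hn)
    (fun j : Option (Fin (Units.rank K)) ↦ j.elim (τ : (𝓞 K)ˣ) (Units.fundSystem K)) e

/-! ### Reduction at a simple root modulo a prime -/

lemma isSquare_eval_of_isSquare_aeval {g : ℤ[X]} {p : ℕ} [Fact p.Prime] {r : ℤ}
    (hr : (p : ℤ) ∣ g.eval r) (hr' : ¬ (p : ℤ) ∣ g.derivative.eval r) {h : ℤ[X]}
    (hh : IsSquare (aeval (rootOf g) h)) : IsSquare ((h.eval r : ℤ) : ZMod p) := by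
  have key (q : ℤ[X]) : aeval (r : ℤ_[p]) q = ((q.eval r : ℤ) : ℤ_[p]) := by
    simpa using (aeval_algebraMap_apply ℤ_[p] r q)
  have hd : ‖aeval (r : ℤ_[p]) g.derivative‖ = 1 := by
    rw [key]
    exact (PadicInt.norm_le_one _).eq_of_not_lt fun h ↦
      hr' ((PadicInt.norm_int_lt_one_iff_dvd _).1 h)
  obtain ⟨z, hz, hzr, -⟩ := hensels_lemma (F := g) (a := (r : ℤ_[p])) <| by
    rw [hd, key, one_pow]
    exact (PadicInt.norm_int_lt_one_iff_dvd _).2 hr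
  rw [hd] at hzr
  have hzp : PadicInt.toZMod z = (r : ZMod p) := by
    have : z - r ∈ RingHom.ker (PadicInt.toZMod (p := p)) := by
      rw [PadicInt.ker_toZMod, IsLocalRing.mem_maximalIdeal, PadicInt.mem_nonunits]
      exact hzr
    rw [RingHom.mem_ker, map_sub, map_intCast] at this
    exact sub_eq_zero.1 this
  have cast (q : ℤ[X]) : aeval (z : ℚ_[p]) q = ((aeval z q : ℤ_[p]) : ℚ_[p]) :=
    aeval_algebraMap_apply ℚ_[p] z q
  obtain ⟨φ, hφ⟩ := exists_algHom g (z : ℚ_[p]) (by rw [cast, hz]; rfl)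
  obtain ⟨y, hy⟩ := hh
  have hφy : ((aeval z h : ℤ_[p]) : ℚ_[p]) = φ y * φ y := by
    rw [← map_mul, ← hy, ← cast, ← hφ]
    exact aeval_algHom_apply (φ.restrictScalars ℤ) (rootOf g) h
  have hy1 : ‖φ y‖ ≤ 1 := by
    have h1 : ‖φ y‖ * ‖φ y‖ ≤ 1 := by
      rw [← norm_mul, ← hφy]
      exact PadicInt.norm_le_one _
    nlinarith [norm_nonneg (φ y)]
  let w : ℤ_[p] := ⟨φ y, hy1⟩
  have hsq : aeval z h = w * w := Subtype.ext hφy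
  refine ⟨PadicInt.toZMod w, ?_⟩
  rw [← map_mul, ← hsq, aeval_def, hom_eval₂, hzp]
  simp [eval₂_eq_eval_map]

/-! ### Irreducibility -/

lemma irreducible_of_irreducible_map_of_natDegree_eq {R S : Type*} [CommRing R] [IsDomain R]
    [Field S] (φ : R →+* S) {f : R[X]} (hf : f.IsPrimitive)
    (hdeg : (f.map φ).natDegree = f.natDegree) (h : Irreducible (f.map φ)) : Irreducible f := by
  have aux {a b : R[X]} (hab : f = a * b) (ha : IsUnit (a.map φ)) : IsUnit a := by
    have hf0 : a * b ≠ 0 := hab ▸ fun h0 ↦ h.ne_zero (by rw [h0, Polynomial.map_zero])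
    have hm0 : a.map φ * b.map φ ≠ 0 := by
      rw [← Polynomial.map_mul, ← hab]
      exact h.ne_zero
    rw [hab, Polynomial.map_mul, natDegree_mul (left_ne_zero_of_mul hm0) (right_ne_zero_of_mul hm0),
      natDegree_mul (left_ne_zero_of_mul hf0) (right_ne_zero_of_mul hf0),
      natDegree_eq_zero_of_isUnit ha] at hdeg
    have := natDegree_map_le (f := φ) (p := b)
    have ha0 : a = C (a.coeff 0) := eq_C_of_natDegree_eq_zero (by omega)
    rw [ha0]
    exact (hf _ ⟨b, ha0 ▸ hab⟩).map C
  refine ⟨fun hu ↦ h.not_isUnit (hu.map (mapRingHom φ)), fun a b hab ↦ ?_⟩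
  exact (h.isUnit_or_isUnit (by rw [hab, Polynomial.map_mul])).imp (aux hab)
    (aux (by rw [hab, mul_comm]))

lemma irreducible_quartic_zmod_seven :
    Irreducible (C 5 * X ^ 4 + C 6 * X ^ 3 + C 5 * X ^ 2 + C 0 * X + C 1 : (ZMod 7)[X]) := by
  have no_root (b : ZMod 7) : 5 * (-b) ^ 4 + 6 * (-b) ^ 3 + 5 * (-b) ^ 2 + 1 ≠ 0 := by
    decide +revert
  have no_factor (b c : ZMod 7) : ¬ (1 = c * (5 - b * (6 - b * 5) - c * 5) ∧
      0 = b * (5 - b * (6 - b * 5) - c * 5) + c * (6 - b * 5)) := by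
    decide +revert
  have h50 : (5 : ZMod 7) ≠ 0 := by decide
  have : Fact (Nat.Prime 7) := ⟨by norm_num⟩
  set P : (ZMod 7)[X] := C 5 * X ^ 4 + C 6 * X ^ 3 + C 5 * X ^ 2 + C 0 * X + C 1 with hP
  have hdeg : P.natDegree = 4 := by
    rw [hP]
    compute_degree!
  have hne : P ≠ 0 := fun h ↦ by simp [h] at hdeg
  rw [irreducible_iff_lt_natDegree_lt hne (not_isUnit_of_natDegree_pos _ (by omega))]
  rintro q hq hqd ⟨s, hs⟩
  rw [hdeg, Finset.mem_Ioc] at hqd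
  have hs0 : s ≠ 0 := by
    rintro rfl
    exact hne (by rw [hs, mul_zero])
  have hsd : q.natDegree + s.natDegree = 4 := by
    rw [← natDegree_mul hq.ne_zero hs0, ← hs, hdeg]
  obtain h1 | h2 : q.natDegree = 1 ∨ q.natDegree = 2 := by omega
  · have := congrArg (eval (-q.coeff 0)) hs
    rw [eval_mul, hq.eq_X_add_C h1] at this
    simp only [hP, eval_add, eval_mul, eval_C, eval_X, eval_pow, coeff_add, coeff_X_zero,
      coeff_C_zero, zero_add, neg_add_cancel, zero_mul, add_zero] at this
    exact no_root _ this
  · have hq2 : q.coeff 2 = 1 := by rw [← h2]; exact hq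
    rw [eq_quadratic_of_degree_le_two (p := q) (natDegree_le_iff_degree_le.1 h2.le), hq2,
      eq_quadratic_of_degree_le_two (p := s) (natDegree_le_iff_degree_le.1 (by omega : _ ≤ 2))] at hs
    generalize q.coeff 1 = b, q.coeff 0 = c, s.coeff 2 = x, s.coeff 1 = y, s.coeff 0 = z at hs
    have hs' : P =
        C x * X ^ 4 + C (y + b * x) * X ^ 3 + C (z + b * y + c * x) * X ^ 2 + C (b * z + c * y) * X
          + C (c * z) := by
      rw [hs]
      simp only [map_add, map_mul, map_one]
      ring
    have hc (n : ℕ) := congrArg (coeff · n) hs'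
    have h4 := hc 4
    have h3 := hc 3
    have h2 := hc 2
    have h1 := hc 1
    have h0 := hc 0
    simp [hP, coeff_X, coeff_C, coeff_X_pow, -map_add, -map_mul, -map_one] at h4 h3 h2 h1 h0
    subst h4
    obtain rfl : y = 6 - b * 5 := by rw [h3]; ring
    obtain rfl : z = 5 - b * (6 - b * 5) - c * 5 := by linear_combination -h2
    exact no_factor b c ⟨h0, h1⟩

lemma irreducible_map_rat {g : ℤ[X]}
    (hg : g = C 5 * X ^ 4 + C (-1) * X ^ 3 + C (-2) * X ^ 2 + C (-7) * X + C (-6)) :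
    Irreducible (g.map (Int.castRingHom ℚ)) := by
  have hdeg : g.natDegree = 4 := by rw [hg]; compute_degree!
  have hprim : g.IsPrimitive := by
    rintro r hr
    have h3 := C_dvd_iff_dvd_coeff r g |>.1 hr 3
    rw [hg] at h3
    simp [coeff_X_pow, -eq_intCast, -map_neg] at h3
    exact isUnit_of_dvd_one h3
  have hmap : g.map (Int.castRingHom (ZMod 7)) =
      C 5 * X ^ 4 + C 6 * X ^ 3 + C 5 * X ^ 2 + C 0 * X + C 1 := by
    rw [hg]
    simp only [Polynomial.map_add, Polynomial.map_mul, Polynomial.map_pow, map_X, map_C]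
    rfl
  have h50 : (5 : ZMod 7) ≠ 0 := by decide
  have : Fact (Nat.Prime 7) := ⟨by norm_num⟩
  refine (IsPrimitive.Int.irreducible_iff_irreducible_map_cast hprim).1 ?_
  refine irreducible_of_irreducible_map_of_natDegree_eq (Int.castRingHom (ZMod 7)) hprim ?_ ?_
  · rw [hmap, hdeg]
    compute_degree!
  · rw [hmap]
    exact irreducible_quartic_zmod_seven

/-! ### A nonreal root -/

lemma exists_aeval_eq_zero_conj_ne {g : ℤ[X]}
    (hg : g = C 5 * X ^ 4 + C (-1) * X ^ 3 + C (-2) * X ^ 2 + C (-7) * X + C (-6)) :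
    ∃ z : ℂ, aeval z g = 0 ∧ (starRingEnd ℂ) z ≠ z := by
  by_contra! hreal
  set G : ℂ[X] := g.map (Int.castRingHom ℂ) with hG
  have hGe (t : ℂ) : G.eval t = 5 * t ^ 4 - t ^ 3 - 2 * t ^ 2 - 7 * t - 6 := by
    rw [hG, hg]
    simp
    ring
  have hdeg : G.natDegree = 4 := by
    rw [hG, hg]
    simp only [Polynomial.map_add, Polynomial.map_mul, Polynomial.map_pow, map_X, map_C]
    compute_degree!
  have hlead : G.leadingCoeff = 5 := by
    rw [leadingCoeff, hdeg, hG, coeff_map, hg]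
    simp [coeff_X_pow, -map_neg, -eq_intCast]
  have hroot (z : ℂ) (hz : z ∈ G.roots) : ∃ w : ℝ, z = w := by
    have : aeval z g = 0 := by
      rw [aeval_def, eval₂_eq_eval_map]
      exact (mem_roots'.1 hz).2
    obtain ⟨w, hw⟩ := Complex.conj_eq_iff_real.1 (hreal z this)
    exact ⟨w, hw⟩
  have hsplit := IsAlgClosed.splits G
  have hcard : G.roots.card = 4 := by rw [← hdeg, hsplit.natDegree_eq_card_roots]
  have hprod := hsplit.eq_prod_roots
  rw [hlead] at hprod
  obtain ⟨w, hw⟩ := Multiset.card_pos_iff_exists_mem.1 (by omega : 0 < G.roots.card)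
  obtain ⟨s, hs⟩ := Multiset.exists_cons_of_mem hw
  rw [hs, Multiset.card_cons, Nat.succ.injEq, Multiset.card_eq_three] at hcard
  obtain ⟨x, y, t, rfl⟩ := hcard
  obtain ⟨w, rfl⟩ := hroot w hw
  obtain ⟨x, rfl⟩ := hroot x (by simp [hs])
  obtain ⟨y, rfl⟩ := hroot y (by simp [hs])
  obtain ⟨t, rfl⟩ := hroot t (by simp [hs])
  have hev (r : ℝ) : 5 * r ^ 4 - r ^ 3 - 2 * r ^ 2 - 7 * r - 6 =
      5 * ((r - w) * ((r - x) * ((r - y) * (r - t)))) := by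
    have := hGe r
    rw [hprod, hs] at this
    simp at this
    exact_mod_cast this.symm
  have h0 := hev 0
  have h1 := hev 1
  have h1' := hev (-1)
  have h2 := hev 2
  ring_nf at h0 h1 h1' h2
  have e4 : w * x * y * t = -6 / 5 := by linarith
  have e2 : w * x + w * y + w * t + x * y + x * t + y * t = -2 / 5 := by linarith
  have e1 : w + x + y + t = 1 / 5 := by linarith
  have e3 : w * x * y + w * x * t + w * y * t + x * y * t = 7 / 5 := by linarith
  have hsum : (w * x) ^ 2 + (w * y) ^ 2 + (w * t) ^ 2 + (x * y) ^ 2 + (x * t) ^ 2 + (y * t) ^ 2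
      = (-2 / 5) ^ 2 - 2 * (1 / 5) * (7 / 5) + 2 * (-6 / 5) := by
    rw [← e1, ← e2, ← e3, ← e4]
    ring
  have : 0 ≤ (w * x) ^ 2 + (w * y) ^ 2 + (w * t) ^ 2 + (x * y) ^ 2 + (x * t) ^ 2 + (y * t) ^ 2 := by
    positivity
  rw [hsum] at this
  norm_num at this

open NumberField in
lemma rank_units_le {K : Type*} [Field K] [NumberField K] (hK : Module.finrank ℚ K = 4)
    (φ : K →+* ℂ) (hφ : ¬ ComplexEmbedding.IsReal φ) : Units.rank K ≤ 2 := by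
  have h1 := InfinitePlace.card_add_two_mul_card_eq_rank K
  have h2 := InfinitePlace.card_eq_nrRealPlaces_add_nrComplexPlaces K
  have h3 : 0 < InfinitePlace.nrComplexPlaces K := by
    classical
    exact Fintype.card_pos_iff.2 ⟨⟨InfinitePlace.mk φ, InfinitePlace.isComplex_mk_iff.2 hφ⟩⟩
  rw [Units.rank]
  omega

open NumberField in
lemma rank_units_Kf_le {g : ℤ[X]}
    (hg : g = C 5 * X ^ 4 + C (-1) * X ^ 3 + C (-2) * X ^ 2 + C (-7) * X + C (-6))
    [Fact (Irreducible (g.map (Int.castRingHom ℚ)))] :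
    Units.rank (Kf g) ≤ 2 := by
  obtain ⟨z, hz, hzz⟩ := exists_aeval_eq_zero_conj_ne hg
  obtain ⟨φ, hφ⟩ := exists_algHom g z hz
  refine rank_units_le ?_ φ.toRingHom fun h ↦ hzz ?_
  · have hne := (Fact.out : Irreducible (g.map (Int.castRingHom ℚ))).ne_zero
    rw [(AdjoinRoot.powerBasis hne).finrank, AdjoinRoot.powerBasis_dim,
      natDegree_map_eq_of_injective Int.cast_injective, natDegree_of_eq (by norm_num) hg]
  · rw [← hφ]
    exact RingHom.congr_fun h (rootOf g)

/-! ### The invariant ideal of `g` is not principal -/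

open NumberField in
lemma exists_isSquare_prod_of_isIntegral {K : Type*} [Field K] [NumberField K] {n : ℕ}
    (hn : Units.rank K + 1 < n) {x y : Fin n → K} (hx : ∀ i, IsIntegral ℤ (x i))
    (hy : ∀ i, IsIntegral ℤ (y i)) (hxy : ∀ i, x i * y i = 1) :
    ∃ s : Finset (Fin n), s.Nonempty ∧ IsSquare (∏ i ∈ s, x i) := by
  let u (i : Fin n) : (𝓞 K)ˣ :=
    Units.mkOfMulEqOne ⟨x i, hx i⟩ ⟨y i, hy i⟩ (RingOfIntegers.ext (hxy i))
  obtain ⟨s, hs, hsq⟩ := exists_isSquare_prod_units hn u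
  refine ⟨s, hs, ?_⟩
  have := hsq.map ((algebraMap (𝓞 K) K : 𝓞 K →* K).comp (Units.coeHom (𝓞 K)))
  rwa [map_prod] at this

lemma isIntegral_of_quartic {A : Type*} [CommRing A] {x : A} (b c d e : ℤ)
    (h : x ^ 4 + b * x ^ 3 + c * x ^ 2 + d * x + e = 0) : IsIntegral ℤ x := by
  refine ⟨X ^ 4 + C b * X ^ 3 + C c * X ^ 2 + C d * X + C e, by monicity!, ?_⟩
  simpa [eval₂_add, eval₂_mul, -eq_intCast] using h

lemma isIntegral_zeta {g : ℤ[X]}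
    (hg : g = C 5 * X ^ 4 + C (-1) * X ^ 3 + C (-2) * X ^ 2 + C (-7) * X + C (-6)) :
    IsIntegral ℤ (zeta g 1) ∧ IsIntegral ℤ (zeta g 2) ∧ IsIntegral ℤ (zeta g 3) := by
  have rel := relation_g hg
  obtain ⟨h1, h2, h3⟩ := zeta_of_eq (by norm_num) hg
  set a := rootOf g
  refine ⟨isIntegral_of_quartic (-1) (-10) (-175) (-750) ?_,
    isIntegral_of_quartic (-4) (-49) (-145) 1122 ?_,
    isIntegral_of_quartic (-21) 159 (-475) (-744) ?_⟩
  · rw [h1]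
    push_cast
    linear_combination 125 * rel
  · rw [h2]
    push_cast
    linear_combination (-187 + 194 * a - 35 * a ^ 2 - 75 * a ^ 3 + 125 * a ^ 4) * rel
  · rw [h3]
    push_cast
    linear_combination (124 - 303 * a + 127 * a ^ 2 + 194 * a ^ 3 + 344 * a ^ 4 - 291 * a ^ 5
      - 135 * a ^ 6 - 75 * a ^ 7 + 125 * a ^ 8) * rel

lemma isIntegral_combination {A : Type*} [CommRing A] {x y z : A} (hx : IsIntegral ℤ x)
    (hy : IsIntegral ℤ y) (hz : IsIntegral ℤ z) (c₀ c₁ c₂ c₃ : ℤ)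
    {v : A} (hv : v = c₀ + c₁ * x + c₂ * y + c₃ * z) : IsIntegral ℤ v := by
  rw [hv]
  have h (c : ℤ) : IsIntegral ℤ (c : A) := isIntegral_algebraMap (x := c)
  exact (((h _).add ((h _).mul hx)).add ((h _).mul hy)).add ((h _).mul hz)

lemma eq_empty_of_isSquare_prod (s : Finset (Fin 4))
    (h11 : IsSquare (∏ i ∈ s, (![-1, 7 + 21 * 2 + 23 * 2 ^ 2 + 10 * 2 ^ 3,
      181 - 2681 * 2 - 2126 * 2 ^ 2 + 2605 * 2 ^ 3,
      5 - 9 * 2 - 11 * 2 ^ 2 + 10 * 2 ^ 3] : Fin 4 → ZMod 11) i))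
    (h5 : IsSquare (∏ i ∈ s, (![-1, 7 + 21 * 4 + 23 * 4 ^ 2 + 10 * 4 ^ 3,
      181 - 2681 * 4 - 2126 * 4 ^ 2 + 2605 * 4 ^ 3,
      5 - 9 * 4 - 11 * 4 ^ 2 + 10 * 4 ^ 3] : Fin 4 → ZMod 5) i))
    (h11' : IsSquare (∏ i ∈ s, (![-1, 7 + 21 * 8 + 23 * 8 ^ 2 + 10 * 8 ^ 3,
      181 - 2681 * 8 - 2126 * 8 ^ 2 + 2605 * 8 ^ 3,
      5 - 9 * 8 - 11 * 8 ^ 2 + 10 * 8 ^ 3] : Fin 4 → ZMod 11) i))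
    (h13 : IsSquare (∏ i ∈ s, (![-1, 7 + 21 * 10 + 23 * 10 ^ 2 + 10 * 10 ^ 3,
      181 - 2681 * 10 - 2126 * 10 ^ 2 + 2605 * 10 ^ 3,
      5 - 9 * 10 - 11 * 10 ^ 2 + 10 * 10 ^ 3] : Fin 4 → ZMod 13) i)) : s = ∅ := by
  revert s
  decide

lemma not_isSquare_prod {g : ℤ[X]}
    (hg : g = C 5 * X ^ 4 + C (-1) * X ^ 3 + C (-2) * X ^ 2 + C (-7) * X + C (-6))
    {s : Finset (Fin 4)} (hs : s.Nonempty) :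
    ¬ IsSquare (∏ i ∈ s, ![-1,
      7 + 21 * rootOf g + 23 * rootOf g ^ 2 + 10 * rootOf g ^ 3,
      181 - 2681 * rootOf g - 2126 * rootOf g ^ 2 + 2605 * rootOf g ^ 3,
      5 - 9 * rootOf g - 11 * rootOf g ^ 2 + 10 * rootOf g ^ 3] i) := by
  intro hsq
  let h : Fin 4 → ℤ[X] := ![-1, 7 + 21 * X + 23 * X ^ 2 + 10 * X ^ 3,
    181 - 2681 * X - 2126 * X ^ 2 + 2605 * X ^ 3, 5 - 9 * X - 11 * X ^ 2 + 10 * X ^ 3]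
  have hsq' : IsSquare (aeval (rootOf g) (∏ i ∈ s, h i)) := by
    rw [map_prod]
    rw [Finset.prod_congr rfl fun i _ ↦ ?_]
    · exact hsq
    · fin_cases i <;> simp [h, map_ofNat]
  have key {p : ℕ} [Fact p.Prime] {r : ℤ} (hr : (p : ℤ) ∣ g.eval r)
      (hr' : ¬ (p : ℤ) ∣ g.derivative.eval r) :
      IsSquare (∏ i ∈ s, (![-1, 7 + 21 * (r : ZMod p) + 23 * r ^ 2 + 10 * r ^ 3,
        181 - 2681 * r - 2126 * r ^ 2 + 2605 * r ^ 3,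
        5 - 9 * r - 11 * r ^ 2 + 10 * r ^ 3] : Fin 4 → ZMod p) i) := by
    convert isSquare_eval_of_isSquare_aeval hr hr' hsq'
    rw [eval_prod, Int.cast_prod]
    refine Finset.prod_congr rfl fun i _ ↦ ?_
    fin_cases i <;> simp [h]
  have : Fact (Nat.Prime 11) := ⟨by norm_num⟩
  have : Fact (Nat.Prime 13) := ⟨by norm_num⟩
  have : Fact (Nat.Prime 5) := ⟨by norm_num⟩
  have h11 := key (p := 11) (r := 2) (by rw [hg]; norm_num) (by rw [hg]; norm_num)
  have h5 := key (p := 5) (r := 4) (by rw [hg]; norm_num) (by rw [hg]; norm_num)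
  have h11' := key (p := 11) (r := 8) (by rw [hg]; norm_num) (by rw [hg]; norm_num)
  have h13 := key (p := 13) (r := 10) (by rw [hg]; norm_num) (by rw [hg]; norm_num)
  exact hs.ne_empty (eq_empty_of_isSquare_prod s (by exact_mod_cast h11) (by exact_mod_cast h5)
    (by exact_mod_cast h11') (by exact_mod_cast h13))

lemma isIntegral_of_invModule_one_eq_smul {g : ℤ[X]}
    (hg : g = C 5 * X ^ 4 + C (-1) * X ^ 3 + C (-2) * X ^ 2 + C (-7) * X + C (-6))
    {κ : (Kf g)ˣ}
    (heq : (invModule g 1 : Set (Kf g)) = (κ : Kf g) • (invModule g 0 : Set (Kf g))) :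
    IsIntegral ℤ ((κ : Kf g) ^ 2 *
      (-2797 - 5154 * rootOf g - 4415 * rootOf g ^ 2 - 3450 * rootOf g ^ 3)) ∧
    IsIntegral ℤ ((5 - 9 * rootOf g - 11 * rootOf g ^ 2 + 10 * rootOf g ^ 3) *
      (↑κ⁻¹ : Kf g) ^ 2) := by
  have hdeg := natDegree_of_eq (by norm_num) hg
  have rel := relation_g hg
  obtain ⟨h1, h2, h3⟩ := zeta_of_eq (by norm_num) hg
  obtain ⟨i1, i2, i3⟩ := isIntegral_zeta hg
  have comb (c₀ c₁ c₂ c₃ : ℤ) {v : Kf g} := isIntegral_combination i1 i2 i3 c₀ c₁ c₂ c₃ (v := v)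
  have hc (c : ℤ) : IsIntegral ℤ (c : Kf g) := isIntegral_algebraMap (x := c)
  have hmul {v : Kf g} (hv : v ∈ invModule g 1) : IsIntegral ℤ ((↑κ⁻¹ : Kf g) * v) := by
    have : v ∈ (κ : Kf g) • (invModule g 0 : Set (Kf g)) := heq ▸ hv
    obtain ⟨w, hw, rfl⟩ := this
    obtain ⟨c₀, c₁, c₂, c₃, hw⟩ := (mem_invModule_zero hdeg).1 hw
    have hκw : (↑κ⁻¹ : Kf g) * (κ : Kf g) • w = w := by simp
    rw [hκw]
    exact comb c₀ c₁ c₂ c₃ hw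
  have hr₀ := hmul ((mem_invModule_one hdeg).2 ⟨1, 0, 0, 0, by simp⟩ : (1 : Kf g) ∈ _)
  have hr₁ := hmul ((mem_invModule_one hdeg).2 ⟨0, 1, 0, 0, by simp⟩ : rootOf g ∈ _)
  have hκ : (κ : Kf g) ∈ invModule g 1 := by
    have : (κ : Kf g) ∈ (κ : Kf g) • (invModule g 0 : Set (Kf g)) :=
      ⟨1, (mem_invModule_zero hdeg).2 ⟨1, 0, 0, 0, by simp⟩, by simp⟩
    rwa [← heq] at this
  obtain ⟨c₀, s, c₂, c₃, hκ⟩ := (mem_invModule_one hdeg).1 hκ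
  generalize hr : (c₀ + ((0 : ℤ) : Kf g) * zeta g 1 + c₂ * zeta g 2 + c₃ * zeta g 3 : Kf g) = r
  have hri := comb c₀ 0 c₂ c₃ hr.symm
  have hκr : (κ : Kf g) = r + s * rootOf g := by
    rw [hκ, ← hr]
    push_cast
    ring
  generalize rootOf g = a at *
  push_cast at h1 h2 h3
  constructor
  · generalize hδ : (-2797 - 5154 * a - 4415 * a ^ 2 - 3450 * a ^ 3 : Kf g) = δ
    have hδ₀ : IsIntegral ℤ δ := by
      refine comb (-2797) (-1511) (-1021) (-690) ?_
      rw [← hδ, h1, h2, h3]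
      push_cast
      ring
    have hδ₁ : IsIntegral ℤ (a * δ) := by
      refine comb (-4140) (-2236) (-1511) (-1021) ?_
      rw [← hδ, h1, h2, h3]
      push_cast
      linear_combination -690 * rel
    have hδ₂ : IsIntegral ℤ (a ^ 2 * δ) := by
      refine comb (-6126) (-3309) (-2236) (-1511) ?_
      rw [← hδ, h1, h2, h3]
      push_cast
      linear_combination (-1021 - 690 * a) * rel
    have heq : (κ : Kf g) ^ 2 * δ =
        r ^ 2 * δ + (2 : ℤ) * (r * s * (a * δ)) + (s : Kf g) ^ 2 * (a ^ 2 * δ) := by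
      rw [hκr]
      push_cast
      ring
    rw [heq]
    exact (((hri.pow 2).mul hδ₀).add ((hc 2).mul ((hri.mul (hc s)).mul hδ₁))).add
      (((hc s).pow 2).mul hδ₂)
  · generalize (↑κ⁻¹ : Kf g) = ρ at *
    have heq : (5 - 9 * a - 11 * a ^ 2 + 10 * a ^ 3) * ρ ^ 2 =
        (5 : ℤ) * (ρ * 1) ^ 2 + (-9 : ℤ) * (ρ * 1 * (ρ * a)) +
          ((2 : ℤ) * zeta g 1 + (-11 : ℤ)) * (ρ * a) ^ 2 := by
      rw [h1]
      push_cast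
      ring
    rw [heq]
    exact (((hc 5).mul (hr₀.pow 2)).add ((hc (-9)).mul (hr₀.mul hr₁))).add
      ((((hc 2).mul i1).add (hc (-11))).mul (hr₁.pow 2))

lemma isIntegral_unit {g : ℤ[X]}
    (hg : g = C 5 * X ^ 4 + C (-1) * X ^ 3 + C (-2) * X ^ 2 + C (-7) * X + C (-6)) :
    IsIntegral ℤ (7 + 21 * rootOf g + 23 * rootOf g ^ 2 + 10 * rootOf g ^ 3) ∧
    IsIntegral ℤ (181 - 2681 * rootOf g - 2126 * rootOf g ^ 2 + 2605 * rootOf g ^ 3) ∧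
    IsIntegral ℤ (-10967 + 2010 * rootOf g - 6369 * rootOf g ^ 2 + 6770 * rootOf g ^ 3) ∧
    IsIntegral ℤ (-202622759 - 373314097 * rootOf g - 319805247 * rootOf g ^ 2
      - 249876565 * rootOf g ^ 3) := by
  obtain ⟨h1, h2, h3⟩ := zeta_of_eq (by norm_num) hg
  obtain ⟨i1, i2, i3⟩ := isIntegral_zeta hg
  refine ⟨isIntegral_combination i1 i2 i3 7 6 5 2 ?_,
    isIntegral_combination i1 i2 i3 181 (-392) (-321) 521 ?_,
    isIntegral_combination i1 i2 i3 (-10967) 743 (-1003) 1354 ?_,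
    isIntegral_combination i1 i2 i3 (-202622759) (-109444167) (-73956112) (-49975313) ?_⟩
  all_goals
    rw [h1, h2, h3]
    push_cast
    ring

lemma invModule_one_ne_smul {g : ℤ[X]}
    (hg : g = C 5 * X ^ 4 + C (-1) * X ^ 3 + C (-2) * X ^ 2 + C (-7) * X + C (-6))
    (κ : (Kf g)ˣ) :
    (invModule g 1 : Set (Kf g)) ≠ (κ : Kf g) • (invModule g 0 : Set (Kf g)) := by
  intro heq
  have rel := relation_g hg
  obtain ⟨iu, iu'⟩ := isIntegral_of_invModule_one_eq_smul hg heq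
  obtain ⟨iε₁, iε₂, iε₁', iε₂'⟩ := isIntegral_unit hg
  have hns {s : Finset (Fin 4)} := not_isSquare_prod hg (s := s)
  have hκ : (κ : Kf g) * (↑κ⁻¹ : Kf g) = 1 := κ.mul_inv
  generalize (↑κ⁻¹ : Kf g) = ρ at *
  generalize rootOf g = a at *
  generalize hε₁ : 7 + 21 * a + 23 * a ^ 2 + 10 * a ^ 3 = ε₁ at *
  generalize hε₂ : 181 - 2681 * a - 2126 * a ^ 2 + 2605 * a ^ 3 = ε₂ at *
  generalize hε₁' : -10967 + 2010 * a - 6369 * a ^ 2 + 6770 * a ^ 3 = ε₁' at *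
  generalize hε₂' : -202622759 - 373314097 * a - 319805247 * a ^ 2 - 249876565 * a ^ 3 = ε₂' at *
  generalize hγ : 5 - 9 * a - 11 * a ^ 2 + 10 * a ^ 3 = γ at *
  generalize hδ : -2797 - 5154 * a - 4415 * a ^ 2 - 3450 * a ^ 3 = δ at *
  have hγδ : γ * δ = 1 := by
    rw [← hγ, ← hδ]
    linear_combination (2331 - 2620 * a - 6900 * a ^ 2) * rel
  have hεε₁ : ε₁ * ε₁' = 1 := by
    rw [← hε₁, ← hε₁']
    linear_combination (12795 + 21112 * a + 13540 * a ^ 2) * rel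
  have hεε₂ : ε₂ * ε₂' = 1 := by
    rw [← hε₂, ← hε₂']
    linear_combination (6112453230 - 86408156322 * a - 130185690365 * a ^ 2) * rel
  have huu : (κ : Kf g) ^ 2 * δ * (γ * ρ ^ 2) = 1 := by
    linear_combination (κ : Kf g) ^ 2 * ρ ^ 2 * hγδ + ((κ : Kf g) * ρ + 1) * hκ
  have hγu : γ = (κ : Kf g) ^ 2 * δ * (ρ * γ * (ρ * γ)) := by
    linear_combination -((κ : Kf g) ^ 2 * ρ ^ 2 * γ) * hγδ - γ * ((κ : Kf g) * ρ + 1) * hκ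
  have : Fact (Irreducible (g.map (Int.castRingHom ℚ))) := ⟨irreducible_map_rat hg⟩
  obtain ⟨t, ht, w, hw⟩ := exists_isSquare_prod_of_isIntegral (K := Kf g) (n := 4)
    (by have := rank_units_Kf_le hg; omega)
    (x := ![-1, ε₁, ε₂, (κ : Kf g) ^ 2 * δ]) (y := ![-1, ε₁', ε₂', γ * ρ ^ 2])
    (Fin.forall_fin_succ.2 ⟨isIntegral_one.neg, Fin.forall_fin_succ.2 ⟨iε₁,
      Fin.forall_fin_succ.2 ⟨iε₂, Fin.forall_fin_one.2 iu⟩⟩⟩)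
    (Fin.forall_fin_succ.2 ⟨isIntegral_one.neg, Fin.forall_fin_succ.2 ⟨iε₁',
      Fin.forall_fin_succ.2 ⟨iε₂', Fin.forall_fin_one.2 iu'⟩⟩⟩)
    (Fin.forall_fin_succ.2 ⟨by simp, Fin.forall_fin_succ.2 ⟨hεε₁,
      Fin.forall_fin_succ.2 ⟨hεε₂, Fin.forall_fin_one.2 huu⟩⟩⟩)
  let d : Fin 4 → Kf g := ![1, 1, 1, ρ * γ]
  refine hns ht ⟨w * ∏ i ∈ t, d i, ?_⟩
  rw [mul_mul_mul_comm, ← hw, ← Finset.prod_mul_distrib, ← Finset.prod_mul_distrib]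
  refine Finset.prod_congr rfl fun i _ ↦ ?_
  fin_cases i
  · simp [d]
  · simp [d]
  · simp [d]
  · exact hγu

end QuarticExample

open Pointwise in
/-- for `f = 4X⁴ - X³ - 62X² + 13X + 255` and
`g = 5X⁴ - X³ - 2X² - 7X - 6`: (a) `R_f ≅ R_g`; (b) `I_f` is principal;
(c) `I_g` is not principal; and in particular no isomorphism of `R_f` with `R_g`
identifies the ideal classes of `I_f` and `I_g`. -/
theorem quartic_example :
    ∀ (f g : Polynomial ℤ),
      f = 4 * Polynomial.X ^ 4 - Polynomial.X ^ 3 - 62 * Polynomial.X ^ 2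
            + 13 * Polynomial.X + 255 →
      g = 5 * Polynomial.X ^ 4 - Polynomial.X ^ 3 - 2 * Polynomial.X ^ 2
            - 7 * Polynomial.X - 6 →
      (∃ φ : Kf f ≃ₐ[ℚ] Kf g,
          φ '' (invModule f 0 : Set (Kf f)) = (invModule g 0 : Set (Kf g))) ∧
      (∃ κ : (Kf f)ˣ,
          (invModule f 1 : Set (Kf f)) = (κ : Kf f) • (invModule f 0 : Set (Kf f))) ∧
      (∀ κ : (Kf g)ˣ,
          (invModule g 1 : Set (Kf g)) ≠ (κ : Kf g) • (invModule g 0 : Set (Kf g))) ∧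
      (¬ ∃ (φ : Kf f ≃ₐ[ℚ] Kf g) (κ : (Kf g)ˣ),
          φ '' (invModule f 0 : Set (Kf f)) = (invModule g 0 : Set (Kf g)) ∧
          φ '' (invModule f 1 : Set (Kf f)) =
            (κ : Kf g) • (invModule g 1 : Set (Kf g))) := by
  rintro f g hf hg
  replace hf : f = C 4 * X ^ 4 + C (-1) * X ^ 3 + C (-62) * X ^ 2 + C 13 * X + C 255 := by
    simp only [hf, map_neg, map_one, map_ofNat]
    ring
  replace hg : g = C 5 * X ^ 4 + C (-1) * X ^ 3 + C (-2) * X ^ 2 + C (-7) * X + C (-6) := by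
    simp only [hg, map_neg, map_one, map_ofNat]
    ring
  obtain ⟨φ₀, hφ₀, hφ₀'⟩ := QuarticExample.exists_algEquiv hf hg
  obtain ⟨κ₀, hκ₀⟩ := QuarticExample.exists_invModule_one_eq_smul hf
  refine ⟨⟨φ₀, QuarticExample.image_invModule_zero hf hg φ₀ hφ₀ hφ₀'⟩, ⟨κ₀, hκ₀⟩,
    QuarticExample.invModule_one_ne_smul hg, ?_⟩
  rintro ⟨φ, κ, h0, h1⟩
  refine QuarticExample.invModule_one_ne_smul hg (κ⁻¹ * Units.map (φ : Kf f →* Kf g) κ₀) ?_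
  have himage : φ '' ((κ₀ : Kf f) • (invModule f 0 : Set (Kf f))) =
      φ (κ₀ : Kf f) • (invModule g 0 : Set (Kf g)) := by
    rw [← h0]
    exact Set.image_smul_distrib φ _ _
  rw [hκ₀, himage] at h1
  calc (invModule g 1 : Set (Kf g))
      = (↑κ⁻¹ : Kf g) • (κ : Kf g) • (invModule g 1 : Set (Kf g)) := by
        rw [smul_smul, Units.inv_mul, one_smul]
    _ = _ := by
        rw [← h1, smul_smul]
        rfl
end
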